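/- Suppose ν > 0 and Y¹, Y² are real-valued radially symmetric Schwartz functions on ℝ^N with ‖Y¹‖_{L²} = ‖Y²‖_{L²} = 1 satisfying Δ²Y¹ − ((N+4)/(N−4))·W^{8/(N−4)}·Y¹ = −ν·Y² and Δ²Y² − W^{8/(N−4)}·Y² = ν·Y¹. Then there exist constants c ∈ (0, 1/2), C > 0 and r₁ > 0 such that for every real-valued radially symmetric Schwartz function g on ℝ^N, (1 − 2c)·∫_{|x| ≤ r₁} |Δg|² dx + c·∫_{|x| ≥ r₁} |Δg|² dx − ((N+4)/(N−4))·∫_{ℝ^N} W^{8/(N−4)}·g² dx ≥ −C·( (∫_{ℝ^N} W·g dx)² + (∫_{ℝ^N} Y²·g dx)² ). -/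

import Mathlib

open MeasureTheory

noncomputable section

abbrev Rn (N : ℕ) : Type := EuclideanSpace ℝ (Fin N)

noncomputable def lapR {N : ℕ} (u : Rn N → ℝ) (x : Rn N) : ℝ :=
  ∑ i : Fin N, iteratedFDeriv ℝ 2 u x (fun _ => EuclideanSpace.single i 1)

noncomputable def lapC {N : ℕ} (u : Rn N → ℂ) (x : Rn N) : ℂ :=
  ∑ i : Fin N, iteratedFDeriv ℝ 2 u x (fun _ => EuclideanSpace.single i 1)

noncomputable def Wfun (N : ℕ) (x : Rn N) : ℝ :=
  ((N : ℝ) * ((N : ℝ) - 4) * ((N : ℝ) ^ 2 - 4)) ^ (((N : ℝ) - 4) / 8) *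
    (1 + ‖x‖ ^ 2) ^ (-(((N : ℝ) - 4) / 2))

noncomputable def LamR {N : ℕ} (v : Rn N → ℝ) (x : Rn N) : ℝ :=
  (((N : ℝ) - 4) / 2) * v x + fderiv ℝ v x x

noncomputable def LamC {N : ℕ} (v : Rn N → ℂ) (x : Rn N) : ℂ :=
  ((((N : ℝ) - 4) / 2) : ℝ) * v x + fderiv ℝ v x x

noncomputable def rescR {N : ℕ} (lam : ℝ) (u : Rn N → ℝ) (x : Rn N) : ℝ :=
  lam ^ (-(((N : ℝ) - 4) / 2)) * u (lam⁻¹ • x)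

noncomputable def fNL (N : ℕ) (z : ℂ) : ℂ :=
  Complex.ofReal (‖z‖ ^ ((8 : ℝ) / ((N : ℝ) - 4))) * z

noncomputable def fNL' (N : ℕ) (z w : ℂ) : ℂ :=
  if z = 0 then 0 else
    Complex.ofReal (‖z‖ ^ ((8 : ℝ) / ((N : ℝ) - 4))) *
      (w + Complex.ofReal (((8 : ℝ) / ((N : ℝ) - 4)) * ((((starRingEnd ℂ) z) * w).re / ‖z‖ ^ 2)) * z)

noncomputable def FNL (N : ℕ) (z : ℂ) : ℝ :=
  (((N : ℝ) - 4) / (2 * (N : ℝ))) * ‖z‖ ^ ((2 * (N : ℝ)) / ((N : ℝ) - 4))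

noncomputable def cexp (θ : ℝ) : ℂ := Complex.exp (Complex.I * θ)

noncomputable def pairC {N : ℕ} (v w : Rn N → ℂ) : ℝ :=
  ∫ x : Rn N, ((starRingEnd ℂ) (v x) * w x).re

noncomputable def energyC {N : ℕ} (u : Rn N → ℂ) : ℝ :=
  (1 / 2) * (∫ x : Rn N, ‖lapC u x‖ ^ 2) - (∫ x : Rn N, FNL N (u x))

noncomputable def enorm2 {N : ℕ} (g : Rn N → ℂ) : ℝ := ∫ x : Rn N, ‖lapC g x‖ ^ 2

/-! ### Exponentially decaying functions on the line -/

def Good (f : ℝ → ℝ) : Prop := Measurable f ∧ ∃ C : ℝ, ∀ s, |f s| ≤ C * Real.exp (-|s|)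

def Bdd (f : ℝ → ℝ) : Prop := Measurable f ∧ ∃ C : ℝ, ∀ s, |f s| ≤ C

lemma Good.add {f g : ℝ → ℝ} (hf : Good f) (hg : Good g) : Good (fun s => f s + g s) := by
  obtain ⟨mf, C, hC⟩ := hf
  obtain ⟨mg, D, hD⟩ := hg
  refine ⟨mf.add mg, C + D, fun s => ?_⟩
  have := abs_add_le (f s) (g s)
  have := hC s
  have := hD s
  linarith

lemma Good.const_mul {f : ℝ → ℝ} (hf : Good f) (c : ℝ) : Good (fun s => c * f s) := by
  obtain ⟨mf, C, hC⟩ := hf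
  refine ⟨mf.const_mul c, |c| * C, fun s => ?_⟩
  rw [abs_mul, mul_assoc]
  exact mul_le_mul_of_nonneg_left (hC s) (abs_nonneg c)

lemma Good.sub {f g : ℝ → ℝ} (hf : Good f) (hg : Good g) : Good (fun s => f s - g s) := by
  have := hf.add (hg.const_mul (-1))
  convert this using 2
  ring

lemma Good.bdd {f : ℝ → ℝ} (hf : Good f) : Bdd f := by
  obtain ⟨mf, C, hC⟩ := hf
  refine ⟨mf, |C|, fun s => (hC s).trans ?_⟩
  have h1 : Real.exp (-|s|) ≤ 1 := by
    rw [Real.exp_le_one_iff]; linarith [abs_nonneg s]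
  have h2 := Real.exp_pos (-|s|)
  have h3 := le_abs_self C
  have h4 := abs_nonneg C
  nlinarith

lemma Good.mul_bdd {f g : ℝ → ℝ} (hf : Good f) (hg : Bdd g) : Good (fun s => f s * g s) := by
  obtain ⟨mf, C, hC⟩ := hf
  obtain ⟨mg, D, hD⟩ := hg
  refine ⟨mf.mul mg, C * D, fun s => ?_⟩
  rw [abs_mul]
  have h1 := mul_le_mul (hC s) (hD s) (abs_nonneg _) ((abs_nonneg _).trans (hC s))
  calc _ ≤ _ := h1
    _ = _ := by ring

lemma Good.bdd_mul {f g : ℝ → ℝ} (hf : Good f) (hg : Bdd g) : Good (fun s => g s * f s) := by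
  simpa only [mul_comm] using hf.mul_bdd hg

lemma Good.mul {f g : ℝ → ℝ} (hf : Good f) (hg : Good g) : Good (fun s => f s * g s) :=
  hf.mul_bdd hg.bdd

lemma Bdd.mul {f g : ℝ → ℝ} (hf : Bdd f) (hg : Bdd g) : Bdd (fun s => f s * g s) := by
  obtain ⟨mf, C, hC⟩ := hf
  obtain ⟨mg, D, hD⟩ := hg
  refine ⟨mf.mul mg, C * D, fun s => ?_⟩
  rw [abs_mul]
  exact mul_le_mul (hC s) (hD s) (abs_nonneg _) ((abs_nonneg _).trans (hC s))

lemma Bdd.add {f g : ℝ → ℝ} (hf : Bdd f) (hg : Bdd g) : Bdd (fun s => f s + g s) := by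
  obtain ⟨mf, C, hC⟩ := hf
  obtain ⟨mg, D, hD⟩ := hg
  refine ⟨mf.add mg, C + D, fun s => ?_⟩
  have := abs_add_le (f s) (g s)
  have := hC s
  have := hD s
  linarith

lemma Bdd.const (c : ℝ) : Bdd (fun _ => c) := ⟨measurable_const, |c|, fun _ => le_rfl⟩

lemma Bdd.sub {f g : ℝ → ℝ} (hf : Bdd f) (hg : Bdd g) : Bdd (fun s => f s - g s) := by
  have := hf.add ((Bdd.const (-1)).mul hg)
  convert this using 2
  ring

lemma Bdd.pow {f : ℝ → ℝ} (hf : Bdd f) (k : ℕ) : Bdd (fun s => f s ^ k) := by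
  induction k with
  | zero => simpa using Bdd.const 1
  | succ k ih => simpa only [pow_succ] using ih.mul hf

lemma Good.sq {f : ℝ → ℝ} (hf : Good f) : Good (fun s => f s ^ 2) := by
  simpa only [pow_two] using hf.mul hf

lemma integrable_exp_neg_mul_abs {a : ℝ} (ha : 0 < a) :
    Integrable (fun s : ℝ => Real.exp (-a * |s|)) := by
  have h1 : IntegrableOn (fun s : ℝ => Real.exp (-a * |s|)) (Set.Ioi 0) := by
    refine (integrableOn_exp_mul_Ioi (a := -a) (by linarith) 0).congr_fun ?_ measurableSet_Ioi
    intro x hx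
    simp only [abs_of_pos (Set.mem_Ioi.1 hx)]
  have h2 : IntegrableOn (fun s : ℝ => Real.exp (-a * |s|)) (Set.Iic 0) := by
    refine (integrableOn_exp_mul_Iic ha 0).congr_fun ?_ measurableSet_Iic
    intro x hx
    simp only [abs_of_nonpos (Set.mem_Iic.1 hx)]
    ring_nf
  have := h2.union h1
  rwa [Set.Iic_union_Ioi, integrableOn_univ] at this

lemma integrable_expabs : Integrable (fun s : ℝ => Real.exp (-|s|)) := by
  simpa using integrable_exp_neg_mul_abs (a := 1) one_pos

lemma Good.integrable {f : ℝ → ℝ} (hf : Good f) : Integrable f := by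
  obtain ⟨mf, C, hC⟩ := hf
  refine (integrable_expabs.const_mul C).mono' mf.aestronglyMeasurable ?_
  exact Filter.Eventually.of_forall fun s => by simpa using hC s

lemma Good.tendsto_top {f : ℝ → ℝ} (hf : Good f) : Filter.Tendsto f Filter.atTop (nhds 0) := by
  obtain ⟨mf, C, hC⟩ := hf
  have h1 : Filter.Tendsto (fun s : ℝ => C * Real.exp (-|s|)) Filter.atTop (nhds (C * 0)) := by
    refine Filter.Tendsto.const_mul C (Real.tendsto_exp_neg_atTop_nhds_zero.comp ?_)
    exact Filter.tendsto_abs_atTop_atTop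
  rw [mul_zero] at h1
  exact squeeze_zero_norm hC h1

lemma Good.tendsto_bot {f : ℝ → ℝ} (hf : Good f) : Filter.Tendsto f Filter.atBot (nhds 0) := by
  obtain ⟨mf, C, hC⟩ := hf
  have h1 : Filter.Tendsto (fun s : ℝ => C * Real.exp (-|s|)) Filter.atBot (nhds (C * 0)) := by
    refine Filter.Tendsto.const_mul C (Real.tendsto_exp_neg_atTop_nhds_zero.comp ?_)
    exact Filter.tendsto_abs_atBot_atTop
  rw [mul_zero] at h1
  exact squeeze_zero_norm hC h1

/-! ### Fundamental theorem of calculus, inequality forms -/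

lemma tendsto_natR : Filter.Tendsto (fun n : ℕ => (n : ℝ) + 1) Filter.atTop Filter.atTop :=
  Filter.tendsto_atTop_add_const_right _ _ tendsto_natCast_atTop_atTop

lemma ftc_line {F B B' : ℝ → ℝ} (hF : Integrable F) (hc : Continuous B)
    (hd : ∀ s, HasDerivWithinAt B (B' s) (Set.Ioi s) s) (hle : ∀ s, B' s ≤ F s)
    (htop : Filter.Tendsto B Filter.atTop (nhds 0))
    (hbot : Filter.Tendsto B Filter.atBot (nhds 0)) : 0 ≤ ∫ s, F s := by
  have hR := tendsto_natR
  have hR' : Filter.Tendsto (fun n : ℕ => -((n : ℝ) + 1)) Filter.atTop Filter.atBot :=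
    Filter.tendsto_neg_atTop_atBot.comp hR
  have h1 := intervalIntegral_tendsto_integral hF hR' hR
  have h2 : Filter.Tendsto (fun n : ℕ => B ((n : ℝ) + 1) - B (-((n : ℝ) + 1))) Filter.atTop
      (nhds (0 - 0)) := (htop.comp hR).sub (hbot.comp hR')
  rw [sub_zero] at h2
  refine le_of_tendsto_of_tendsto' h2 h1 fun n => ?_
  exact intervalIntegral.sub_le_integral_of_hasDeriv_right_of_le
    (by have : (0:ℝ) ≤ n := n.cast_nonneg
        linarith) hc.continuousOn (fun x _ => hd x) hF.integrableOn (fun x _ => hle x)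

lemma ftc_line_eq {B B' : ℝ → ℝ} (hF : Integrable B') (hc : Continuous B)
    (hd : ∀ s, HasDerivWithinAt B (B' s) (Set.Ioi s) s)
    (htop : Filter.Tendsto B Filter.atTop (nhds 0))
    (hbot : Filter.Tendsto B Filter.atBot (nhds 0)) : ∫ s, B' s = 0 := by
  have h1 := ftc_line hF hc hd (fun s => le_rfl) htop hbot
  have h2 := ftc_line (F := fun s => - B' s) (B := fun s => - B s) (B' := fun s => - B' s)
    hF.neg hc.neg (fun s => (hd s).neg) (fun s => le_rfl) (by simpa using htop.neg)
    (by simpa using hbot.neg)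
  rw [integral_neg] at h2
  linarith

lemma ftc_punct {F B B' : ℝ → ℝ} (hF : Integrable F) (hc : ∀ s, s ≠ 0 → ContinuousAt B s)
    (hd : ∀ s, s ≠ 0 → HasDerivWithinAt B (B' s) (Set.Ioi s) s) (hle : ∀ s, s ≠ 0 → B' s ≤ F s)
    (h0 : Filter.Tendsto B (nhdsWithin 0 {0}ᶜ) (nhds 0))
    (htop : Filter.Tendsto B Filter.atTop (nhds 0))
    (hbot : Filter.Tendsto B Filter.atBot (nhds 0)) : 0 ≤ ∫ s, F s := by
  have hR := tendsto_natR
  have hR' : Filter.Tendsto (fun n : ℕ => -((n : ℝ) + 1)) Filter.atTop Filter.atBot :=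
    Filter.tendsto_neg_atTop_atBot.comp hR
  have he : Filter.Tendsto (fun n : ℕ => ((n : ℝ) + 1)⁻¹) Filter.atTop (nhds 0) :=
    tendsto_inv_atTop_zero.comp hR
  have he1 : Filter.Tendsto (fun n : ℕ => ((n : ℝ) + 1)⁻¹) Filter.atTop (nhdsWithin 0 {0}ᶜ) := by
    refine tendsto_nhdsWithin_iff.2 ⟨he, Filter.Eventually.of_forall fun n => ?_⟩
    have : (0:ℝ) < (n:ℝ) + 1 := by positivity
    simpa using this.ne'
  have he' : Filter.Tendsto (fun n : ℕ => -((n : ℝ) + 1)⁻¹) Filter.atTop (nhds 0) := by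
    simpa using he.neg
  have he1' : Filter.Tendsto (fun n : ℕ => -((n : ℝ) + 1)⁻¹) Filter.atTop
      (nhdsWithin 0 {0}ᶜ) := by
    refine tendsto_nhdsWithin_iff.2 ⟨he', Filter.Eventually.of_forall fun n => ?_⟩
    have : (0:ℝ) < (n:ℝ) + 1 := by positivity
    simpa using this.ne'
  have hprim : Continuous (fun x : ℝ => ∫ y in (0:ℝ)..x, F y) :=
    intervalIntegral.continuous_primitive (fun a b => hF.intervalIntegrable) 0
  have hp1 := (hprim.tendsto 0).comp he
  have hp2 := (hprim.tendsto 0).comp he'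
  have h1 := (intervalIntegral_tendsto_integral hF hR' hR).sub (hp1.sub hp2)
  have h2 := ((htop.comp hR).sub (hbot.comp hR')).sub ((h0.comp he1).sub (h0.comp he1'))
  simp only [intervalIntegral.integral_same, sub_zero] at h1 h2
  refine le_of_tendsto_of_tendsto' h2 h1 fun n => ?_
  have hn : (0:ℝ) < (n:ℝ) + 1 := by positivity
  have hni : (0:ℝ) < ((n:ℝ) + 1)⁻¹ := by positivity
  have hle1 : ((n:ℝ) + 1)⁻¹ ≤ (n:ℝ) + 1 := by
    have h3 : ((n:ℝ) + 1)⁻¹ ≤ 1 := inv_le_one_of_one_le₀ (by simp)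
    have : (0:ℝ) ≤ n := n.cast_nonneg
    linarith
  have k1 := intervalIntegral.sub_le_integral_of_hasDeriv_right_of_le (g := B) (g' := B') (φ := F)
    hle1 (fun x hx => (hc x (by linarith [hx.1])).continuousWithinAt)
    (fun x hx => hd x (by linarith [hx.1])) hF.integrableOn
    (fun x hx => hle x (by linarith [hx.1]))
  have k2 := intervalIntegral.sub_le_integral_of_hasDeriv_right_of_le (g := B) (g' := B') (φ := F)
    (neg_le_neg hle1) (fun x hx => (hc x (by linarith [hx.2])).continuousWithinAt)
    (fun x hx => hd x (by linarith [hx.2])) hF.integrableOn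
    (fun x hx => hle x (by linarith [hx.2]))
  have hi : ∀ a b : ℝ, IntervalIntegrable F volume a b := fun a b => hF.intervalIntegrable
  have e1 := intervalIntegral.integral_add_adjacent_intervals
    (hi (-((n:ℝ)+1)) (-((n:ℝ)+1)⁻¹)) (hi (-((n:ℝ)+1)⁻¹) 0)
  have e2 := intervalIntegral.integral_add_adjacent_intervals
    (hi 0 (((n:ℝ)+1)⁻¹)) (hi (((n:ℝ)+1)⁻¹) ((n:ℝ)+1))
  have e3 := intervalIntegral.integral_add_adjacent_intervals
    (hi (-((n:ℝ)+1)) 0) (hi 0 ((n:ℝ)+1))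
  have e4 := intervalIntegral.integral_symm (f := F) (μ := volume) (-((n:ℝ)+1)⁻¹) 0
  simp only [Function.comp_apply]
  linarith

/-! ### The hyperbolic tangent -/

lemma hasDerivAt_th (s : ℝ) : HasDerivAt Real.tanh (1 - Real.tanh s ^ 2) s := by
  have h : HasDerivAt (fun x => Real.sinh x / Real.cosh x) _ s :=
    (Real.hasDerivAt_sinh s).div (Real.hasDerivAt_cosh s) (Real.cosh_pos s).ne'
  have h2 : Real.tanh = fun x => Real.sinh x / Real.cosh x := by
    funext x; exact Real.tanh_eq_sinh_div_cosh x
  rw [← h2] at h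
  convert h using 1
  rw [Real.tanh_eq_sinh_div_cosh]
  have := (Real.cosh_pos s).ne'
  field_simp

lemma cont_th : Continuous Real.tanh := by
  rw [continuous_iff_continuousAt]
  exact fun s => (hasDerivAt_th s).continuousAt

lemma bdd_th : Bdd Real.tanh :=
  ⟨cont_th.measurable, 1, fun s => (Real.abs_tanh_lt_one s).le⟩

lemma th_sq_lt (s : ℝ) : Real.tanh s ^ 2 < 1 := by
  rw [sq_lt_one_iff_abs_lt_one]; exact Real.abs_tanh_lt_one s

lemma th_ne {s : ℝ} (hs : s ≠ 0) : Real.tanh s ≠ 0 := by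
  intro h
  rw [Real.tanh_eq_sinh_div_cosh, div_eq_zero_iff] at h
  rcases h with h | h
  · exact hs (Real.sinh_eq_zero.1 h)
  · exact (Real.cosh_pos s).ne' h

/-- the class of admissible radial profiles in logarithmic variables, with two derivatives -/
def XM : Submodule ℝ ((ℝ → ℝ) × (ℝ → ℝ) × (ℝ → ℝ)) where
  carrier := {p | Continuous p.1 ∧ Continuous p.2.1 ∧
    (∀ s, HasDerivWithinAt p.1 (p.2.1 s) (Set.Ioi s) s) ∧
    (∀ s, HasDerivWithinAt p.2.1 (p.2.2 s) (Set.Ioi s) s) ∧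
    Good p.1 ∧ Good p.2.1 ∧ Good p.2.2}
  add_mem' := by
    rintro a b ⟨h1, h2, h3, h4, h5, h6, h7⟩ ⟨k1, k2, k3, k4, k5, k6, k7⟩
    exact ⟨h1.add k1, h2.add k2, fun s => (h3 s).add (k3 s), fun s => (h4 s).add (k4 s),
      h5.add k5, h6.add k6, h7.add k7⟩
  zero_mem' := by
    have h0 : Good (0 : ℝ → ℝ) := ⟨measurable_zero, 0, by simp⟩
    refine ⟨continuous_zero, continuous_zero, fun s => ?_, fun s => ?_, h0, h0, h0⟩
    · exact hasDerivWithinAt_const _ _ _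
    · exact hasDerivWithinAt_const _ _ _
  smul_mem' := by
    rintro c a ⟨h1, h2, h3, h4, h5, h6, h7⟩
    exact ⟨h1.const_smul c, h2.const_smul c, fun s => (h3 s).const_smul c,
      fun s => (h4 s).const_smul c, h5.const_mul c, h6.const_mul c, h7.const_mul c⟩

def XS : Type := ↥XM
instance : AddCommGroup XS := inferInstanceAs (AddCommGroup ↥XM)
instance : Module ℝ XS := inferInstanceAs (Module ℝ ↥XM)

namespace XS
def f0 (v : XS) : ℝ → ℝ := (show ↥XM from v).1.1
def f1 (v : XS) : ℝ → ℝ := (show ↥XM from v).1.2.1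
def f2 (v : XS) : ℝ → ℝ := (show ↥XM from v).1.2.2
lemma c0 (v : XS) : Continuous v.f0 := (show ↥XM from v).2.1
lemma c1 (v : XS) : Continuous v.f1 := (show ↥XM from v).2.2.1
lemma d0 (v : XS) (s : ℝ) : HasDerivWithinAt v.f0 (v.f1 s) (Set.Ioi s) s := (show ↥XM from v).2.2.2.1 s
lemma d1 (v : XS) (s : ℝ) : HasDerivWithinAt v.f1 (v.f2 s) (Set.Ioi s) s := (show ↥XM from v).2.2.2.2.1 s
lemma g0 (v : XS) : Good v.f0 := (show ↥XM from v).2.2.2.2.2.1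
lemma g1 (v : XS) : Good v.f1 := (show ↥XM from v).2.2.2.2.2.2.1
lemma g2 (v : XS) : Good v.f2 := (show ↥XM from v).2.2.2.2.2.2.2
lemma f0_add (v w : XS) (s : ℝ) : (v + w).f0 s = v.f0 s + w.f0 s := rfl
lemma f1_add (v w : XS) (s : ℝ) : (v + w).f1 s = v.f1 s + w.f1 s := rfl
lemma f2_add (v w : XS) (s : ℝ) : (v + w).f2 s = v.f2 s + w.f2 s := rfl
lemma f0_smul (c : ℝ) (v : XS) (s : ℝ) : (c • v).f0 s = c * v.f0 s := rfl
lemma f1_smul (c : ℝ) (v : XS) (s : ℝ) : (c • v).f1 s = c * v.f1 s := rfl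
lemma f2_smul (c : ℝ) (v : XS) (s : ℝ) : (c • v).f2 s = c * v.f2 s := rfl

/-- the radial Laplacian in logarithmic variables -/
def D (γ : ℝ) (v : XS) (s : ℝ) : ℝ := v.f2 s + 2 * v.f1 s - γ * (γ + 2) * v.f0 s

lemma gD (γ : ℝ) (v : XS) : Good (v.D γ) :=
  (v.g2.add (v.g1.const_mul 2)).sub (v.g0.const_mul _)
lemma D_add (γ : ℝ) (v w : XS) (s : ℝ) : (v + w).D γ s = v.D γ s + w.D γ s := by
  simp only [D, f0_add, f1_add, f2_add]; ring
lemma D_smul (γ c : ℝ) (v : XS) (s : ℝ) : (c • v).D γ s = c * v.D γ s := by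
  simp only [D, f0_smul, f1_smul, f2_smul]; ring
end XS

def sg (s : ℝ) : ℝ := 1 - Real.tanh s ^ 2

lemma sg_pos (s : ℝ) : 0 < sg s := by have := th_sq_lt s; unfold sg; linarith
lemma sg_le (s : ℝ) : sg s ≤ 1 := by unfold sg; nlinarith [sq_nonneg (Real.tanh s)]
lemma cont_sg : Continuous sg := by
  unfold sg; exact continuous_const.sub (cont_th.pow 2)
lemma bdd_sg : Bdd sg := by
  exact (Bdd.const 1).sub (bdd_th.pow 2)
lemma hasDerivAt_sg (s : ℝ) : HasDerivAt sg (-2 * Real.tanh s * sg s) s := by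
  have := ((hasDerivAt_th s).pow 2).const_sub 1
  refine HasDerivAt.congr_deriv (f := sg) this ?_
  unfold sg
  push_cast
  ring

/-- the energy form -/
def Efm (γ : ℝ) : XS →ₗ[ℝ] XS →ₗ[ℝ] ℝ :=
  LinearMap.mk₂ ℝ (fun v w => ∫ s, v.D γ s * w.D γ s)
    (fun v v' w => by
      simp only [XS.D_add, add_mul]
      exact integral_add ((v.gD γ).mul (w.gD γ)).integrable ((v'.gD γ).mul (w.gD γ)).integrable)
    (fun c v w => by
      simp only [XS.D_smul, mul_assoc, smul_eq_mul]
      exact integral_const_mul _ _)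
    (fun v w w' => by
      simp only [XS.D_add, mul_add]
      exact integral_add ((v.gD γ).mul (w.gD γ)).integrable ((v.gD γ).mul (w'.gD γ)).integrable)
    (fun c v w => by
      simp only [XS.D_smul, mul_left_comm, smul_eq_mul]
      exact integral_const_mul _ _)

lemma gsv (v : XS) : Good (fun s => sg s ^ 2 * v.f0 s) := v.g0.bdd_mul (bdd_sg.pow 2)

/-- the potential form -/
def Pfm : XS →ₗ[ℝ] XS →ₗ[ℝ] ℝ :=
  LinearMap.mk₂ ℝ (fun v w => ∫ s, sg s ^ 2 * v.f0 s * w.f0 s)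
    (fun v v' w => by
      simp only [XS.f0_add, add_mul, mul_add]
      exact integral_add ((gsv v).mul w.g0).integrable ((gsv v').mul w.g0).integrable)
    (fun c v w => by
      simp only [XS.f0_smul, smul_eq_mul]
      rw [← integral_const_mul]
      congr 1; funext s; ring)
    (fun v w w' => by
      simp only [XS.f0_add, mul_add]
      exact integral_add ((gsv v).mul w.g0).integrable ((gsv v).mul w'.g0).integrable)
    (fun c v w => by
      simp only [XS.f0_smul, smul_eq_mul]
      rw [← integral_const_mul]
      congr 1; funext s; ring)

lemma Efm_apply (γ : ℝ) (v w : XS) : Efm γ v w = ∫ s, v.D γ s * w.D γ s := rfl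
lemma Pfm_apply (v w : XS) : Pfm v w = ∫ s, sg s ^ 2 * v.f0 s * w.f0 s := rfl

lemma quad_deriv (v : XS) {α β κ : ℝ → ℝ} {α' β' κ' s : ℝ} (ha : HasDerivAt α α' s)
    (hb : HasDerivAt β β' s) (hk : HasDerivAt κ κ' s) :
    HasDerivWithinAt (fun x => α x * v.f1 x ^ 2 + β x * (v.f0 x * v.f1 x) + κ x * v.f0 x ^ 2)
      (α' * v.f1 s ^ 2 + α s * (2 * v.f1 s * v.f2 s) + (β' * (v.f0 s * v.f1 s)
        + β s * (v.f1 s * v.f1 s + v.f0 s * v.f2 s)) + (κ' * v.f0 s ^ 2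
        + κ s * (2 * v.f0 s * v.f1 s))) (Set.Ioi s) s := by
  have h1 := (ha.hasDerivWithinAt (s := Set.Ioi s)).mul ((v.d1 s).pow 2)
  have h2 := (hb.hasDerivWithinAt (s := Set.Ioi s)).mul ((v.d0 s).mul (v.d1 s))
  have h3 := (hk.hasDerivWithinAt (s := Set.Ioi s)).mul ((v.d0 s).pow 2)
  refine ((h1.add h2).add h3).congr_deriv ?_
  simp only [Pi.pow_apply, Pi.mul_apply]
  push_cast
  ring

lemma quad_good (v : XS) {α β κ : ℝ → ℝ} (ha : Bdd α) (hb : Bdd β) (hk : Bdd κ) :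
    Good (fun x => α x * v.f1 x ^ 2 + β x * (v.f0 x * v.f1 x) + κ x * v.f0 x ^ 2) :=
  ((v.g1.sq.bdd_mul ha).add ((v.g0.mul v.g1).bdd_mul hb)).add (v.g0.sq.bdd_mul hk)

lemma quad_contAt (v : XS) {α β κ : ℝ → ℝ} {s : ℝ} (ha : ContinuousAt α s)
    (hb : ContinuousAt β s) (hk : ContinuousAt κ s) :
    ContinuousAt (fun x => α x * v.f1 x ^ 2 + β x * (v.f0 x * v.f1 x) + κ x * v.f0 x ^ 2) s := by
  have := v.c0.continuousAt (x := s)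
  have := v.c1.continuousAt (x := s)
  fun_prop

lemma Efm_lower {γ : ℝ} (hγ : 1 ≤ γ) (v : XS) :
    ∫ s, (v.f0 s ^ 2 + v.f1 s ^ 2) ≤ Efm γ v v := by
  have hF1 : Integrable (fun s => v.D γ s * v.D γ s) := ((v.gD γ).mul (v.gD γ)).integrable
  have hF2 : Integrable (fun s => v.f0 s ^ 2 + v.f1 s ^ 2) := (v.g0.sq.add v.g1.sq).integrable
  have := ftc_line (hF1.sub hF2)
    (B := fun x => (fun _ => (2:ℝ)) x * v.f1 x ^ 2
      + (fun _ => -2*(γ*(γ+2))) x * (v.f0 x * v.f1 x) + (fun _ => -2*(γ*(γ+2))) x * v.f0 x ^ 2)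
    (continuous_iff_continuousAt.2 fun s => quad_contAt v continuousAt_const continuousAt_const
      continuousAt_const)
    (fun s => quad_deriv v (hasDerivAt_const s _) (hasDerivAt_const s _) (hasDerivAt_const s _))
    (fun s => ?_)
    (quad_good v (Bdd.const _) (Bdd.const _) (Bdd.const _)).tendsto_top
    (quad_good v (Bdd.const _) (Bdd.const _) (Bdd.const _)).tendsto_bot
  · simp only [Pi.sub_apply] at this
    rw [integral_sub hF1 hF2] at this
    rw [Efm_apply]
    linarith
  · simp only [Pi.sub_apply, XS.D]
    have hb : 1 ≤ γ * (γ + 2) := by nlinarith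
    set b := γ * (γ + 2)
    nlinarith [sq_nonneg (v.f2 s), mul_nonneg (by linarith : 0 ≤ b) (sq_nonneg (v.f1 s)),
      mul_nonneg (by nlinarith : 0 ≤ b ^ 2 - 1) (sq_nonneg (v.f0 s)), sq_nonneg (v.f1 s)]

lemma Efm_nonneg (γ : ℝ) (v : XS) : 0 ≤ Efm γ v v := by
  rw [Efm_apply]
  exact integral_nonneg fun s => mul_self_nonneg _

lemma sobolev {γ : ℝ} (hγ : 1 ≤ γ) (v : XS) (s : ℝ) : v.f0 s ^ 2 ≤ Efm γ v v := by
  refine le_trans ?_ (Efm_lower hγ v)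
  have hF : Integrable (fun s => v.f0 s ^ 2 + v.f1 s ^ 2) := (v.g0.sq.add v.g1.sq).integrable
  have hlim : Filter.Tendsto (fun r => v.f0 s ^ 2 - v.f0 r ^ 2) Filter.atBot
      (nhds (v.f0 s ^ 2 - 0)) := tendsto_const_nhds.sub v.g0.sq.tendsto_bot
  rw [sub_zero] at hlim
  refine le_of_tendsto hlim ?_
  filter_upwards [Filter.eventually_le_atBot s] with r hr
  have k := intervalIntegral.sub_le_integral_of_hasDeriv_right_of_le
    (g := fun x => v.f0 x ^ 2) (g' := fun x => 2 * v.f0 x * v.f1 x) hr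
    ((v.c0.pow 2).continuousOn)
    (fun x _ => by
      refine ((v.d0 x).pow 2).congr_deriv ?_
      push_cast; ring) hF.integrableOn (fun x _ => by nlinarith [sq_nonneg (v.f0 x - v.f1 x)])
  refine k.trans ?_
  rw [intervalIntegral.integral_of_le hr]
  exact setIntegral_le_integral hF (Filter.Eventually.of_forall fun x => by positivity)

lemma der_poly3 (c0 c1 c3 s : ℝ) :
    HasDerivAt (fun x => c0 + c1 * Real.tanh x + c3 * Real.tanh x ^ 3)
      ((c1 + 3 * c3 * Real.tanh s ^ 2) * (1 - Real.tanh s ^ 2)) s := by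
  have h := hasDerivAt_th s
  have := ((h.const_mul c1).const_add c0).add ((h.pow 3).const_mul c3)
  refine this.congr_deriv ?_
  push_cast; ring

lemma der_poly2 (c0 c2 s : ℝ) :
    HasDerivAt (fun x => c0 + c2 * Real.tanh x ^ 2)
      ((2 * c2 * Real.tanh s) * (1 - Real.tanh s ^ 2)) s := by
  have h := hasDerivAt_th s
  have := ((h.pow 2).const_mul c2).const_add c0
  refine this.congr_deriv ?_
  push_cast; ring

lemma bdd_poly3 (c0 c1 c3 : ℝ) : Bdd (fun x => c0 + c1 * Real.tanh x + c3 * Real.tanh x ^ 3) :=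
  ((Bdd.const c0).add ((Bdd.const c1).mul bdd_th)).add ((Bdd.const c3).mul (bdd_th.pow 3))

lemma bdd_poly2 (c0 c2 : ℝ) : Bdd (fun x => c0 + c2 * Real.tanh x ^ 2) :=
  (Bdd.const c0).add ((Bdd.const c2).mul (bdd_th.pow 2))

/-- positivity of `L₋` in quantitative form -/
lemma Lminus {γ : ℝ} (hγ : 1 ≤ γ) (v : XS) :
    (∫ s, sg s * (v.f1 s + γ * Real.tanh s * v.f0 s) ^ 2)
      ≤ Efm γ v v - γ * (γ + 1) * (γ + 2) * (γ + 3) * Pfm v v := by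
  have hp : Good (fun s => v.f1 s + γ * Real.tanh s * v.f0 s) :=
    v.g1.add (v.g0.bdd_mul ((Bdd.const γ).mul bdd_th))
  have hF1 : Integrable (fun s => v.D γ s * v.D γ s) := ((v.gD γ).mul (v.gD γ)).integrable
  have hF2 : Integrable (fun s => sg s ^ 2 * v.f0 s * v.f0 s) := ((gsv v).mul v.g0).integrable
  have hF3 : Integrable (fun s => sg s * (v.f1 s + γ * Real.tanh s * v.f0 s) ^ 2) :=
    (hp.sq.bdd_mul bdd_sg).integrable
  have := ftc_line ((hF1.sub (hF2.const_mul (γ * (γ + 1) * (γ + 2) * (γ + 3)))).sub hF3)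
    (B := fun x => (fun x => 2 + (-(2*γ+2)) * Real.tanh x + 0 * Real.tanh x ^ 3) x * v.f1 x ^ 2
      + (fun x => (-2*(γ*(γ+2))-2*γ) + (-2*(γ*(γ+2)-γ)) * Real.tanh x ^ 2) x
          * (v.f0 x * v.f1 x)
      + (fun x => (-2*(γ*(γ+2))) +
          (-(2*γ+2)*γ - (2*γ^2+8*γ+6)*γ + 2*(γ*(γ+2)-γ)) * Real.tanh x
          + (-(2*γ+2)*(γ*(γ+2)-γ) + (2*γ^2+8*γ+6)*γ - 2*(γ*(γ+2)-γ)) * Real.tanh x ^ 3) x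
        * v.f0 x ^ 2)
    (continuous_iff_continuousAt.2 fun s => quad_contAt v (der_poly3 _ _ _ s).continuousAt
      (der_poly2 _ _ s).continuousAt (der_poly3 _ _ _ s).continuousAt)
    (fun s => quad_deriv v (der_poly3 _ _ _ s) (der_poly2 _ _ s) (der_poly3 _ _ _ s))
    (fun s => ?_)
    (quad_good v (bdd_poly3 _ _ _) (bdd_poly2 _ _) (bdd_poly3 _ _ _)).tendsto_top
    (quad_good v (bdd_poly3 _ _ _) (bdd_poly2 _ _) (bdd_poly3 _ _ _)).tendsto_bot
  · simp only [Pi.sub_apply] at this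
    rw [integral_sub (by exact hF1.sub (hF2.const_mul _)) hF3,
      integral_sub hF1 (hF2.const_mul _), integral_const_mul] at this
    rw [Efm_apply, Pfm_apply]
    linarith
  · simp only [Pi.sub_apply, XS.D, sg]
    have ht := th_sq_lt s
    set t := Real.tanh s
    set x := v.f0 s
    set y := v.f1 s
    set z := v.f2 s
    have h1 : 0 ≤ (z + (2*γ+2)*t*y + (γ*(1-t^2) + γ*(γ+2)*t^2)*x)^2
      + (2*γ^2+8*γ+5) * ((1-t^2) * (y+γ*t*x)^2) := by
      have : 0 ≤ (1-t^2) * (y+γ*t*x)^2 := mul_nonneg (by linarith) (sq_nonneg _)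
      positivity
    rw [← sub_nonneg]
    refine h1.trans_eq ?_
    ring

lemma th_mono : StrictMono Real.tanh :=
  strictMono_of_hasDerivAt_pos hasDerivAt_th (fun s => by have := th_sq_lt s; linarith)

lemma f_lin {f f' : ℝ → ℝ} {C : ℝ} (hc : Continuous f) (h0 : f 0 = 0)
    (hd : ∀ s, HasDerivWithinAt f (f' s) (Set.Ioi s) s) (hb : ∀ s, |f' s| ≤ C) (s : ℝ) :
    |f s| ≤ C * |s| := by
  have hd' : ∀ s, HasDerivWithinAt f (f' s) (Set.Ici s) s := fun s =>
    hasDerivWithinAt_Ioi_iff_Ici.1 (hd s)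
  rcases le_total 0 s with h | h
  · have := norm_image_sub_le_of_norm_deriv_right_le_segment (f := f) (f' := f') (a := 0) (b := s)
      (C := C) hc.continuousOn (fun x _ => hd' x) (fun x _ => hb x) s ⟨h, le_rfl⟩
    simpa [h0, abs_of_nonneg h] using this
  · have := norm_image_sub_le_of_norm_deriv_right_le_segment (f := f) (f' := f') (a := s) (b := 0)
      (C := C) hc.continuousOn (fun x _ => hd' x) (fun x _ => hb x) 0 ⟨h, le_rfl⟩
    simpa [h0, abs_of_nonpos h] using this

lemma sq_div_th_zero {f : ℝ → ℝ} {C : ℝ} (h : ∀ s, |f s| ≤ C * |s|) :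
    Filter.Tendsto (fun s => f s ^ 2 / Real.tanh s) (nhdsWithin 0 {0}ᶜ) (nhds 0) := by
  have h1 : Filter.Tendsto (fun s => f s ^ 2 / s) (nhdsWithin 0 {0}ᶜ) (nhds 0) := by
    have h2 : Filter.Tendsto (fun s : ℝ => C ^ 2 * |s|) (nhdsWithin 0 {0}ᶜ) (nhds 0) := by
      have : Filter.Tendsto (fun s : ℝ => C ^ 2 * |s|) (nhds 0) (nhds (C ^ 2 * |0|)) :=
        (continuous_const.mul continuous_abs).tendsto 0
      rw [abs_zero, mul_zero] at this
      exact this.mono_left nhdsWithin_le_nhds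
    refine squeeze_zero_norm' ?_ h2
    filter_upwards [self_mem_nhdsWithin] with s hs
    have hs' : 0 < |s| := abs_pos.2 hs
    rw [Real.norm_eq_abs, abs_div, abs_pow, div_le_iff₀ hs']
    have := pow_le_pow_left₀ (abs_nonneg _) (h s) 2
    nlinarith
  have h3 : Filter.Tendsto (fun s => Real.tanh s / s) (nhdsWithin 0 {0}ᶜ) (nhds 1) := by
    have := (hasDerivAt_iff_tendsto_slope_zero).1 (hasDerivAt_th 0)
    simp only [zero_add, Real.tanh_zero, sub_zero, smul_eq_mul] at this
    convert this using 2
    · rw [div_eq_inv_mul]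
    · norm_num
  have h4 := h1.div h3 one_ne_zero
  rw [zero_div] at h4
  refine h4.congr' ?_
  filter_upwards [self_mem_nhdsWithin] with s hs
  have : s ≠ 0 := hs
  have := th_ne this
  simp only [Pi.div_apply]
  field_simp

lemma sq_div_th_top {f : ℝ → ℝ} (h : Good f) :
    Filter.Tendsto (fun s => f s ^ 2 / Real.tanh s) Filter.atTop (nhds 0) := by
  have h1 := (h.sq.const_mul (Real.tanh 1)⁻¹).tendsto_top
  refine squeeze_zero_norm' ?_ h1
  filter_upwards [Filter.eventually_ge_atTop 1] with s hs
  have h2 : Real.tanh 1 ≤ Real.tanh s := th_mono.monotone hs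
  have h3 : 0 < Real.tanh 1 := by simpa using th_mono one_pos
  rw [Real.norm_eq_abs, abs_div, abs_pow, sq_abs, abs_of_pos (h3.trans_le h2), div_eq_inv_mul]
  gcongr

lemma sq_div_th_bot {f : ℝ → ℝ} (h : Good f) :
    Filter.Tendsto (fun s => f s ^ 2 / Real.tanh s) Filter.atBot (nhds 0) := by
  have h1 := (h.sq.const_mul (Real.tanh 1)⁻¹).tendsto_bot
  refine squeeze_zero_norm' ?_ h1
  filter_upwards [Filter.eventually_le_atBot (-1)] with s hs
  have h2 : Real.tanh s ≤ -Real.tanh 1 := by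
    rw [← Real.tanh_neg]; exact th_mono.monotone hs
  have h3 : 0 < Real.tanh 1 := by simpa using th_mono one_pos
  rw [Real.norm_eq_abs, abs_div, abs_pow, sq_abs, abs_of_neg (by linarith), div_eq_inv_mul]
  have : Real.tanh 1 ≤ -Real.tanh s := by linarith
  gcongr

/-- spectral gap for profiles clamped at the origin -/
lemma Lplus_clamped {γ : ℝ} (hγ : 1 ≤ γ) (v : XS) (h0 : v.f0 0 = 0) (h1 : v.f1 0 = 0) :
    (γ + 2) * (γ + 3) * (γ ^ 2 + 5 * γ + 8) * Pfm v v ≤ Efm γ v v := by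
  have hF1 : Integrable (fun s => v.D γ s * v.D γ s) := ((v.gD γ).mul (v.gD γ)).integrable
  have hF2 : Integrable (fun s => sg s ^ 2 * v.f0 s * v.f0 s) := ((gsv v).mul v.g0).integrable
  obtain ⟨C1, hC1⟩ := v.g1.bdd.2
  obtain ⟨C2, hC2⟩ := v.g2.bdd.2
  have l0 := f_lin v.c0 h0 v.d0 hC1
  have l1 := f_lin v.c1 h1 v.d1 hC2
  have hα : ∀ s, s ≠ 0 → HasDerivAt
      (fun x => 2 + (-(2*γ+2)) * Real.tanh x + 0 * Real.tanh x ^ 3 + sg x / Real.tanh x)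
      (((-(2*γ+2)) + 3 * 0 * Real.tanh s ^ 2) * (1 - Real.tanh s ^ 2)
        + (-2 * sg s - sg s ^ 2 / Real.tanh s ^ 2)) s := by
    intro s hs
    have ht := th_ne hs
    refine (der_poly3 _ _ _ s).add ?_
    refine ((hasDerivAt_sg s).div (hasDerivAt_th s) ht).congr_deriv ?_
    simp only [sg]
    field_simp
  have hκ : ∀ c0 c1 c3 s, s ≠ 0 → HasDerivAt
      (fun x => c0 + c1 * Real.tanh x + c3 * Real.tanh x ^ 3
        + 2*(γ+2)*(γ+3) * (sg x ^ 2 / Real.tanh x))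
      ((c1 + 3 * c3 * Real.tanh s ^ 2) * (1 - Real.tanh s ^ 2)
        + 2*(γ+2)*(γ+3) * (-4 * sg s ^ 2 - sg s ^ 3 / Real.tanh s ^ 2)) s := by
    intro c0 c1 c3 s hs
    have ht := th_ne hs
    refine (der_poly3 _ _ _ s).add ?_
    refine HasDerivAt.const_mul _ ?_
    refine (((hasDerivAt_sg s).pow 2).div (hasDerivAt_th s) ht).congr_deriv ?_
    simp only [sg, Pi.pow_apply]
    push_cast
    field_simp
    ring
  let q1 : ℝ := -(2*γ+2)*γ - (2*γ^2+8*γ+6)*γ + 2*(γ*(γ+2)-γ) + γ^2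
  let q3 : ℝ := -(2*γ+2)*(γ*(γ+2)-γ) + (2*γ^2+8*γ+6)*γ - 2*(γ*(γ+2)-γ) - γ^2
  let B : ℝ → ℝ := fun x =>
    (fun x => 2 + (-(2*γ+2)) * Real.tanh x + 0 * Real.tanh x ^ 3 + sg x / Real.tanh x) x
        * v.f1 x ^ 2
      + (fun x => (-2*(γ*(γ+2))) + (-2*(γ*(γ+2))) * Real.tanh x ^ 2) x * (v.f0 x * v.f1 x)
      + (fun x => (-2*(γ*(γ+2))) + q1 * Real.tanh x + q3 * Real.tanh x ^ 3
          + 2*(γ+2)*(γ+3) * (sg x ^ 2 / Real.tanh x)) x * v.f0 x ^ 2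
  let B0 : ℝ → ℝ := fun x =>
    (fun x => 2 + (-(2*γ+2)) * Real.tanh x + 0 * Real.tanh x ^ 3) x * v.f1 x ^ 2
      + (fun x => (-2*(γ*(γ+2))) + (-2*(γ*(γ+2))) * Real.tanh x ^ 2) x * (v.f0 x * v.f1 x)
      + (fun x => (-2*(γ*(γ+2))) + q1 * Real.tanh x + q3 * Real.tanh x ^ 3) x * v.f0 x ^ 2
  have hB0 : Good B0 := quad_good v (bdd_poly3 _ _ _) (bdd_poly2 _ _) (bdd_poly3 _ _ _)
  have hB0c : Continuous B0 := continuous_iff_continuousAt.2 fun s =>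
    quad_contAt v (der_poly3 _ _ _ s).continuousAt
      (der_poly2 _ _ s).continuousAt (der_poly3 _ _ _ s).continuousAt
  have hBB : B = fun x => B0 x + sg x * (v.f1 x ^ 2 / Real.tanh x)
      + 2*(γ+2)*(γ+3) * (sg x ^ 2 * (v.f0 x ^ 2 / Real.tanh x)) := by
    funext x
    simp only [B, B0]
    ring
  have hlim : ∀ l : Filter ℝ, Filter.Tendsto B0 l (nhds 0) →
      Filter.Tendsto (fun s => v.f1 s ^ 2 / Real.tanh s) l (nhds 0) →
      Filter.Tendsto (fun s => v.f0 s ^ 2 / Real.tanh s) l (nhds 0) →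
      Filter.Tendsto B l (nhds 0) := by
    intro l k0 k1 k2
    have m1 : Filter.Tendsto (fun x => sg x * (v.f1 x ^ 2 / Real.tanh x)) l (nhds 0) := by
      refine squeeze_zero_norm (a := fun s => ‖v.f1 s ^ 2 / Real.tanh s‖) (fun s => ?_)
        (by simpa using k1.norm)
      rw [norm_mul]
      refine mul_le_of_le_one_left (norm_nonneg _) ?_
      rw [Real.norm_eq_abs, abs_of_pos (sg_pos s)]
      exact sg_le s
    have m2 : Filter.Tendsto (fun x => sg x ^ 2 * (v.f0 x ^ 2 / Real.tanh x)) l (nhds 0) := by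
      refine squeeze_zero_norm (a := fun s => ‖v.f0 s ^ 2 / Real.tanh s‖) (fun s => ?_)
        (by simpa using k2.norm)
      rw [norm_mul]
      refine mul_le_of_le_one_left (norm_nonneg _) ?_
      rw [Real.norm_eq_abs, abs_pow, abs_of_pos (sg_pos s)]
      exact pow_le_one₀ (sg_pos s).le (sg_le s)
    rw [hBB]
    simpa using (k0.add m1).add (m2.const_mul (2*(γ+2)*(γ+3)))
  have := ftc_punct
    (hF1.sub (hF2.const_mul ((γ + 2) * (γ + 3) * (γ ^ 2 + 5 * γ + 8)))) (B := B)
    (fun s hs => quad_contAt v (hα s hs).continuousAt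
      (der_poly2 _ _ s).continuousAt (hκ _ _ _ s hs).continuousAt)
    (fun s hs => quad_deriv v (hα s hs) (der_poly2 _ _ s) (hκ _ _ _ s hs))
    (fun s hs => ?_)
    (hlim _ ?_ (sq_div_th_zero l1) (sq_div_th_zero l0))
    (hlim _ hB0.tendsto_top (sq_div_th_top v.g1) (sq_div_th_top v.g0))
    (hlim _ hB0.tendsto_bot (sq_div_th_bot v.g1) (sq_div_th_bot v.g0))
  · simp only [Pi.sub_apply] at this
    rw [integral_sub hF1 (hF2.const_mul _), integral_const_mul] at this
    rw [Efm_apply, Pfm_apply]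
    linarith
  · simp only [Pi.sub_apply, XS.D, sg, q1, q3]
    have ht := th_sq_lt s
    have ht0 := th_ne hs
    set t := Real.tanh s
    set x := v.f0 s
    set y := v.f1 s
    set z := v.f2 s
    have h1 : 0 ≤ (z + (2*γ+2)*t*y + (γ*(1-t^2) + γ*(γ+2)*t^2)*x - (1-t^2)*(y+γ*t*x)/t)^2
      + 2*(γ+2)*(γ+3) * ((1-t^2) * (y+γ*t*x - (1-t^2)*x/t)^2) := by
      have : 0 ≤ (1-t^2) * (y+γ*t*x- (1-t^2)*x/t)^2 := mul_nonneg (by linarith) (sq_nonneg _)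
      positivity
    rw [← sub_nonneg]
    refine h1.trans_eq ?_
    field_simp
    ring
  · have := hB0c.tendsto 0
    have e : B0 0 = 0 := by simp [B0, h0, h1]
    rw [e] at this
    exact this.mono_left nhdsWithin_le_nhds

/-! ### Abstract coercivity -/

set_option maxHeartbeats 1000000 in
lemma abstract_coercive {V : Type*} [AddCommGroup V] [Module ℝ V] (E Q : V →ₗ[ℝ] V →ₗ[ℝ] ℝ)
    (hEs : ∀ v w, E v w = E w v) (hQs : ∀ v w, Q v w = Q w v) (hE : ∀ v, 0 ≤ E v v)
    (y z : V) (e0 e1 m : V →ₗ[ℝ] ℝ) (hz : ∀ v, Q z v = 0) (he0 : e0 z = 0) (he1 : e1 z ≠ 0)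
    (hm : m z ≠ 0) {d : ℝ} (hd : 0 < d)
    (hco : ∀ v, e0 v = 0 → e1 v = 0 → d * E v v ≤ Q v v) (hy : Q y y < 0)
    {M : ℝ} (hM : ∀ v, (m v) ^ 2 ≤ M * E v v) :
    ∃ d' C : ℝ, 0 < d' ∧ 0 < C ∧
      ∀ v, d' * E v v - C * ((m v) ^ 2 + (Q y v) ^ 2) ≤ Q v v := by
  have hM0 : 0 ≤ M := by
    by_contra hneg
    push Not at hneg
    have h1 := hM z
    have h2 := hE z
    have : 0 < (m z) ^ 2 := by positivity
    nlinarith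
  have hey : e0 y ≠ 0 := by
    intro h
    have h1 := hco (y - (e1 y / e1 z) • z) (by simp [h, he0]) (by simp [he1])
    have h2 := hE (y - (e1 y / e1 z) • z)
    have h3 : Q (y - (e1 y / e1 z) • z) (y - (e1 y / e1 z) • z) = Q y y := by
      simp [hz, hQs _ z]
    rw [h3] at h1
    nlinarith
  set q := - Q y y with hq
  have hq0 : 0 < q := by linarith
  -- constants
  set mz := m z
  have hmz : 0 < mz ^ 2 := by positivity
  set k := E y y
  set l := E z z
  have hk : 0 ≤ k := hE y
  have hl : 0 ≤ l := hE z
  have hpar : ∀ a b c : V, E (a + b + c) (a + b + c) ≤ 3 * (E a a + E b b + E c c) := by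
    intro a b c
    have h1 := hE (a - b)
    have h2 := hE (b - c)
    have h3 := hE (a - c)
    simp only [map_sub, map_add, LinearMap.sub_apply, LinearMap.add_apply, hEs b a, hEs c a,
      hEs c b] at h1 h2 h3 ⊢
    linarith
  -- the bound of E v v
  set K : ℝ := 3 * (k + 1 + 3 * (l / mz ^ 2) * (1 + (m y) ^ 2 + M)) with hK
  have hKpos : 0 < K := by
    have : 0 ≤ l / mz ^ 2 := by positivity
    positivity
  set r := min (q / 2) d with hr
  have hr0 : 0 < r := lt_min (by linarith) hd
  refine ⟨r / K, max (r * 1) (2 / q), by positivity, lt_max_of_lt_left (by linarith), fun v => ?_⟩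
  set s := e0 v / e0 y with hs
  set v' := v - s • y with hv'
  have hv'0 : e0 v' = 0 := by simp [hv', hs, hey]
  set α := e1 v' / e1 z with hα
  set w := v' - α • z with hw
  have hw0 : e0 w = 0 := by simp [hw, hv'0, he0]
  have hw1 : e1 w = 0 := by simp [hw, hα, he1]
  have hwQ := hco w hw0 hw1
  have hQw : Q w w = Q v' v' := by simp [hw, hz, hQs _ z]
  have hQv : Q v v = Q w w + 2 * s * Q y v + s ^ 2 * q := by
    rw [hQw, hv', hq]
    simp only [map_sub, map_smul, LinearMap.sub_apply, LinearMap.smul_apply, smul_eq_mul,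
      hQs v y]
    ring
  have hdec : v = s • y + α • z + w := by rw [hw, hv']; abel
  have hEv : E v v ≤ 3 * (s ^ 2 * k + α ^ 2 * l + E w w) := by
    have := hpar (s • y) (α • z) w
    rw [← hdec] at this
    simp only [map_smul, LinearMap.smul_apply, smul_eq_mul] at this
    linarith
  have hmv : α * mz = m v - s * m y - m w := by
    have : m v = m (s • y + α • z + w) := by rw [← hdec]
    simp only [map_add, map_smul, smul_eq_mul] at this
    linarith
  set x := E w w
  have hx : 0 ≤ x := hE w
  have hα2 : α ^ 2 * mz ^ 2 ≤ 3 * ((m v) ^ 2 + s ^ 2 * (m y) ^ 2 + M * x) := by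
    have h1 := hM w
    have h2 : α ^ 2 * mz ^ 2 = (m v - s * m y - m w) ^ 2 := by rw [← hmv]; ring
    rw [h2]
    nlinarith [sq_nonneg (m v + s * m y), sq_nonneg (m v + m w), sq_nonneg (s * m y - m w)]
  have hα3 : α ^ 2 * l ≤ 3 * (l / mz ^ 2) * ((m v) ^ 2 + s ^ 2 * (m y) ^ 2 + M * x) := by
    have : α ^ 2 * l = (l / mz ^ 2) * (α ^ 2 * mz ^ 2) := by field_simp
    rw [this]
    have h0 : 0 ≤ l / mz ^ 2 := by positivity
    have := mul_le_mul_of_nonneg_left hα2 h0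
    linarith
  have hEK : E v v ≤ K * (s ^ 2 + x + (m v) ^ 2) := by
    refine hEv.trans ?_
    have h0 : 0 ≤ l / mz ^ 2 := by positivity
    set L := l / mz ^ 2
    rw [hK]
    have p1 : 0 ≤ L * (m y) ^ 2 * x := by positivity
    have p2 : 0 ≤ L * (m y) ^ 2 * (m v) ^ 2 := by positivity
    have p3 : 0 ≤ L * M * s ^ 2 := by positivity
    have p4 : 0 ≤ L * M * (m v) ^ 2 := by positivity
    have p5 : 0 ≤ L * s ^ 2 := by positivity
    have p6 : 0 ≤ L * x := by positivity
    have p7 : 0 ≤ k * x := by positivity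
    have p8 : 0 ≤ k * (m v) ^ 2 := by positivity
    have p9 : 0 ≤ (m v) ^ 2 := by positivity
    have p10 : 0 ≤ s ^ 2 := by positivity
    have key : 3 * (k + 1 + 3 * L * (1 + (m y) ^ 2 + M)) * (s ^ 2 + x + (m v) ^ 2)
        = 3 * (s ^ 2 * k + 3 * L * ((m v) ^ 2 + s ^ 2 * (m y) ^ 2 + M * x) + x)
          + 3 * (k * x + k * (m v) ^ 2 + s ^ 2 + (m v) ^ 2 + 3 * (L * s ^ 2 + L * x
            + L * (m y) ^ 2 * x + L * (m y) ^ 2 * (m v) ^ 2 + L * M * s ^ 2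
            + L * M * (m v) ^ 2)) := by ring
    rw [key]
    have hR : 0 ≤ 3 * (k * x + k * (m v) ^ 2 + s ^ 2 + (m v) ^ 2 + 3 * (L * s ^ 2 + L * x
            + L * (m y) ^ 2 * x + L * (m y) ^ 2 * (m v) ^ 2 + L * M * s ^ 2
            + L * M * (m v) ^ 2)) := by positivity
    refine le_trans ?_ (le_add_of_nonneg_right hR)
    gcongr
  have hfin : r / K * E v v ≤ r * (s ^ 2 + x + (m v) ^ 2) := by
    rw [div_mul_eq_mul_div, div_le_iff₀ hKpos]
    nlinarith
  have hC1 : r ≤ max (r * 1) (2 / q) := by simp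
  have hC2 : 2 / q ≤ max (r * 1) (2 / q) := le_max_right _ _
  set C := max (r * 1) (2 / q)
  have g1 : r * (m v) ^ 2 ≤ C * (m v) ^ 2 := mul_le_mul_of_nonneg_right hC1 (sq_nonneg _)
  have g2 : 2 / q * (Q y v) ^ 2 ≤ C * (Q y v) ^ 2 := mul_le_mul_of_nonneg_right hC2 (sq_nonneg _)
  have g3 : r * x ≤ d * x := mul_le_mul_of_nonneg_right (min_le_right _ _) hx
  have g4 : r * s ^ 2 ≤ q / 2 * s ^ 2 := mul_le_mul_of_nonneg_right (min_le_left _ _) (sq_nonneg _)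
  have g5 : 0 ≤ q / 2 * s ^ 2 + 2 * s * Q y v + 2 / q * (Q y v) ^ 2 := by
    have : q / 2 * s ^ 2 + 2 * s * Q y v + 2 / q * (Q y v) ^ 2
        = (q * s + 2 * Q y v) ^ 2 / (2 * q) := by field_simp; ring
    rw [this]; positivity
  rw [hQv]
  linarith

/-! ### The kernel profile and the weight -/

def ce (γ s : ℝ) : ℝ := Real.cosh s ^ (-γ)

lemma ce_pos (γ s : ℝ) : 0 < ce γ s := Real.rpow_pos_of_pos (Real.cosh_pos s) _

lemma ce_deriv (γ s : ℝ) : HasDerivAt (ce γ) (-γ * Real.tanh s * ce γ s) s := by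
  have hc := Real.cosh_pos s
  have := (Real.hasDerivAt_cosh s).rpow_const (p := -γ) (Or.inl hc.ne')
  refine HasDerivAt.congr_deriv (f := ce γ) this ?_
  rw [Real.rpow_sub_one hc.ne', Real.tanh_eq_sinh_div_cosh, ce]
  ring

lemma cosh_ge (s : ℝ) : Real.exp |s| / 2 ≤ Real.cosh s := by
  rw [← Real.cosh_abs, Real.cosh_eq]
  have := Real.exp_pos (-|s|)
  linarith

lemma ce_le {γ : ℝ} (hγ : 0 ≤ γ) (s : ℝ) : ce γ s ≤ 2 ^ γ * Real.exp (-γ * |s|) := by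
  have h1 : ce γ s ≤ (Real.exp |s| / 2) ^ (-γ) := by
    exact Real.rpow_le_rpow_of_nonpos (by positivity) (cosh_ge s) (by linarith)
  refine h1.trans_eq ?_
  rw [Real.div_rpow (Real.exp_pos _).le (by norm_num), ← Real.exp_mul, Real.rpow_neg (by norm_num)]
  field_simp

lemma ce_cont (γ : ℝ) : Continuous (ce γ) :=
  continuous_iff_continuousAt.2 fun s => (ce_deriv γ s).continuousAt

lemma ce_good {γ : ℝ} (hγ : 1 ≤ γ) : Good (ce γ) := by
  refine ⟨(ce_cont γ).measurable, 2 ^ γ, fun s => ?_⟩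
  rw [abs_of_pos (ce_pos γ s)]
  refine (ce_le (by linarith) s).trans ?_
  gcongr
  nlinarith [abs_nonneg s]

lemma sg_eq (s : ℝ) : sg s = (Real.cosh s ^ 2)⁻¹ := by
  have hc := (Real.cosh_pos s).ne'
  have := Real.cosh_sq s
  rw [sg, Real.tanh_eq_sinh_div_cosh]
  field_simp
  linarith

lemma sg_le_exp (s : ℝ) : sg s ≤ 4 * Real.exp (-2 * |s|) := by
  have h1 := cosh_ge s
  have h2 : (Real.exp |s| / 2) ^ 2 ≤ Real.cosh s ^ 2 := by gcongr
  rw [sg_eq]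
  refine (inv_anti₀ (by positivity) h2).trans_eq ?_
  rw [div_pow, ← Real.exp_nat_mul, inv_div, neg_mul, Real.exp_neg]
  push_cast
  field_simp
  norm_num

lemma good_poly_ce {γ : ℝ} (hγ : 1 ≤ γ) {P : ℝ → ℝ} (hP : Bdd P) :
    Good (fun s => P s * ce γ s) := (ce_good hγ).bdd_mul hP

lemma pce_deriv {γ : ℝ} {P : ℝ → ℝ} {P' s : ℝ} (hP : HasDerivAt P P' s) :
    HasDerivAt (fun s => P s * ce γ s) ((P' - γ * Real.tanh s * P s) * ce γ s) s := by
  refine (hP.mul (ce_deriv γ s)).congr_deriv ?_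
  ring

lemma zmem {γ : ℝ} (hγ : 1 ≤ γ) :
    ((fun s => (0 + 1 * Real.tanh s + 0 * Real.tanh s ^ 3) * ce γ s,
      fun s => (1 + (-(1 + γ)) * Real.tanh s ^ 2) * ce γ s,
      fun s => (0 + (-(3 * γ + 2)) * Real.tanh s + ((γ + 1) * (γ + 2)) * Real.tanh s ^ 3)
        * ce γ s) :
      (ℝ → ℝ) × (ℝ → ℝ) × (ℝ → ℝ)) ∈ XM := by
  have h0 : ∀ s, HasDerivAt (fun s => (0 + 1 * Real.tanh s + 0 * Real.tanh s ^ 3) * ce γ s)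
      ((1 + (-(1 + γ)) * Real.tanh s ^ 2) * ce γ s) s := by
    intro s
    refine (pce_deriv (der_poly3 0 1 0 s)).congr_deriv ?_
    ring
  have h1 : ∀ s, HasDerivAt (fun s => (1 + (-(1 + γ)) * Real.tanh s ^ 2) * ce γ s)
      ((0 + (-(3 * γ + 2)) * Real.tanh s + ((γ + 1) * (γ + 2)) * Real.tanh s ^ 3) * ce γ s) s := by
    intro s
    refine (pce_deriv (der_poly2 1 (-(1+γ)) s)).congr_deriv ?_
    ring
  refine ⟨continuous_iff_continuousAt.2 fun s => (h0 s).continuousAt,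
    continuous_iff_continuousAt.2 fun s => (h1 s).continuousAt,
    fun s => (h0 s).hasDerivWithinAt, fun s => (h1 s).hasDerivWithinAt,
    good_poly_ce hγ (bdd_poly3 _ _ _), good_poly_ce hγ (bdd_poly2 _ _),
    good_poly_ce hγ (bdd_poly3 _ _ _)⟩

def zX {γ : ℝ} (hγ : 1 ≤ γ) : XS := ⟨_, zmem hγ⟩

lemma zX_f0 {γ : ℝ} (hγ : 1 ≤ γ) (s : ℝ) :
    (zX hγ).f0 s = (0 + 1 * Real.tanh s + 0 * Real.tanh s ^ 3) * ce γ s := rfl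
lemma zX_f1 {γ : ℝ} (hγ : 1 ≤ γ) (s : ℝ) :
    (zX hγ).f1 s = (1 + (-(1 + γ)) * Real.tanh s ^ 2) * ce γ s := rfl
lemma zX_f2 {γ : ℝ} (hγ : 1 ≤ γ) (s : ℝ) :
    (zX hγ).f2 s = (0 + (-(3 * γ + 2)) * Real.tanh s + ((γ + 1) * (γ + 2)) * Real.tanh s ^ 3)
        * ce γ s := rfl

lemma zX_ker {γ : ℝ} (hγ : 1 ≤ γ) (w : XS) :
    Efm γ (zX hγ) w - (γ + 1) * (γ + 2) * (γ + 3) * (γ + 4) * Pfm (zX hγ) w = 0 := by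
  have hF1 : Integrable (fun s => (zX hγ).D γ s * w.D γ s) :=
    (((zX hγ).gD γ).mul (w.gD γ)).integrable
  have hF2 : Integrable (fun s => sg s ^ 2 * (zX hγ).f0 s * w.f0 s) :=
    ((gsv _).mul w.g0).integrable
  -- Dz = R0 * ce
  let R0 : ℝ → ℝ := fun s => (2 + (-(3*γ+2) - γ*(γ+2)) * Real.tanh s
    + ((γ + 1) * (γ + 2)) * Real.tanh s ^ 3) + (0 + (-2*(1+γ)) * Real.tanh s ^ 2)
  have hR0d : ∀ s, HasDerivAt R0 (((-(3*γ+2) - γ*(γ+2)) + 3 * ((γ + 1) * (γ + 2)) *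
      Real.tanh s ^ 2) * (1 - Real.tanh s ^ 2)
      + (2 * (-2*(1+γ)) * Real.tanh s) * (1 - Real.tanh s ^ 2)) s := fun s =>
    (der_poly3 _ _ _ s).add (der_poly2 _ _ s)
  let R1 : ℝ → ℝ := fun s => (((-(3*γ+2) - γ*(γ+2)) + 3 * ((γ + 1) * (γ + 2)) *
      Real.tanh s ^ 2) * (1 - Real.tanh s ^ 2)
      + (2 * (-2*(1+γ)) * Real.tanh s) * (1 - Real.tanh s ^ 2)) - γ * Real.tanh s * R0 s
  have hR1c : ∃ R1' : ℝ → ℝ, (∀ s, HasDerivAt R1 (R1' s) s) ∧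
      ∀ s, (R1' s - γ * Real.tanh s * R1 s) - 2 * R1 s - γ * (γ + 2) * R0 s
        = (γ + 1) * (γ + 2) * (γ + 3) * (γ + 4) * (1 - Real.tanh s ^ 2) ^ 2 * Real.tanh s := by
    refine ⟨_, fun s => ((((der_poly2 (-(3*γ+2) - γ*(γ+2)) (3 * ((γ + 1) * (γ + 2))) s).mul
      (((hasDerivAt_th s).pow 2).const_sub 1)).add
      (((hasDerivAt_th s).const_mul (2 * (-2*(1+γ)))).mul
      (((hasDerivAt_th s).pow 2).const_sub 1))).sub
      (((hasDerivAt_th s).const_mul γ).mul (hR0d s))), fun s => ?_⟩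
    simp only [R1, R0, Pi.pow_apply]
    push_cast
    ring
  obtain ⟨R1', hR1d, hR1e⟩ := hR1c
  have bR0 : Bdd R0 := (bdd_poly3 _ _ _).add (bdd_poly2 _ _)
  have bR1 : Bdd R1 := by
    refine (((bdd_poly2 _ _).mul ((Bdd.const 1).sub (bdd_th.pow 2))).add
      (((Bdd.const _).mul bdd_th).mul ((Bdd.const 1).sub (bdd_th.pow 2)))).sub
      (((Bdd.const γ).mul bdd_th).mul bR0)
  have hA0 : ∀ s, HasDerivAt (fun s => R0 s * ce γ s) (R1 s * ce γ s) s := fun s =>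
    pce_deriv (hR0d s)
  have hA1 : ∀ s, HasDerivAt (fun s => R1 s * ce γ s)
    ((R1' s - γ * Real.tanh s * R1 s) * ce γ s) s := fun s => pce_deriv (hR1d s)
  have hDz : ∀ s, (zX hγ).D γ s = R0 s * ce γ s := by
    intro s
    simp only [XS.D, zX_f0, zX_f1, zX_f2, R0]
    ring
  have key := ftc_line_eq
    (hF1.sub (hF2.const_mul ((γ + 1) * (γ + 2) * (γ + 3) * (γ + 4))))
    (B := fun s => (R0 s * ce γ s) * (w.f1 s + 2 * w.f0 s) - (R1 s * ce γ s) * w.f0 s)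
    (by
      have a0 : Continuous (fun s => R0 s * ce γ s) :=
        continuous_iff_continuousAt.2 fun s => (hA0 s).continuousAt
      have a1 : Continuous (fun s => R1 s * ce γ s) :=
        continuous_iff_continuousAt.2 fun s => (hA1 s).continuousAt
      exact (a0.mul (w.c1.add (continuous_const.mul w.c0))).sub (a1.mul w.c0))
    (fun s => by
      have a0 := (hA0 s).hasDerivWithinAt (s := Set.Ioi s)
      have a1 := (hA1 s).hasDerivWithinAt (s := Set.Ioi s)
      refine ((a0.mul ((w.d1 s).add ((w.d0 s).const_mul 2))).sub
        (a1.mul (w.d0 s))).congr_deriv ?_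
      simp only [Pi.sub_apply, hDz]
      have e1 := hR1e s
      simp only [XS.D, zX_f0, sg, Pi.add_apply]
      linear_combination (- ce γ s * w.f0 s) * e1)
    (((good_poly_ce hγ bR0).mul (w.g1.add (w.g0.const_mul 2))).sub
      ((good_poly_ce hγ bR1).mul w.g0)).tendsto_top
    (((good_poly_ce hγ bR0).mul (w.g1.add (w.g0.const_mul 2))).sub
      ((good_poly_ce hγ bR1).mul w.g0)).tendsto_bot
  simp only [Pi.sub_apply] at key
  rw [integral_sub hF1 (hF2.const_mul _), integral_const_mul] at key
  exact key

/-- the weight representing the pairing with the ground state -/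
def mw (γ s : ℝ) : ℝ := Real.exp (4 * s) * ce γ s

lemma mw_pos (γ s : ℝ) : 0 < mw γ s := mul_pos (Real.exp_pos _) (ce_pos γ s)

lemma mw_cont (γ : ℝ) : Continuous (mw γ) := by
  have := ce_cont γ
  unfold mw
  fun_prop

lemma mw_int {γ : ℝ} (hγ : 9 / 2 ≤ γ) : Integrable (fun s => mw γ s * Real.exp (s / 4)) := by
  refine ((integrable_exp_neg_mul_abs (a := 1/4) (by norm_num)).const_mul (2 ^ γ)).mono'
    (((mw_cont γ).mul (by fun_prop)).aestronglyMeasurable) (Filter.Eventually.of_forall fun s => ?_)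
  have h0 := mul_pos (mw_pos γ s) (Real.exp_pos (s/4))
  rw [Real.norm_eq_abs, abs_of_pos h0]
  have h1 := ce_le (by linarith : 0 ≤ γ) s
  calc mw γ s * Real.exp (s/4)
      ≤ Real.exp (4*s) * (2 ^ γ * Real.exp (-γ * |s|)) * Real.exp (s/4) := by
        unfold mw; gcongr
    _ = 2 ^ γ * Real.exp (4*s + -γ*|s| + s/4) := by rw [Real.exp_add, Real.exp_add]; ring
    _ ≤ 2 ^ γ * Real.exp (-(1/4) * |s|) := by
        gcongr
        nlinarith [abs_nonneg s, le_abs_self s]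

lemma mw_int0 {γ : ℝ} (hγ : 9 / 2 ≤ γ) : Integrable (mw γ) := by
  refine ((integrable_exp_neg_mul_abs (a := 1/2) (by norm_num)).const_mul (2 ^ γ)).mono'
    ((mw_cont γ).aestronglyMeasurable) (Filter.Eventually.of_forall fun s => ?_)
  rw [Real.norm_eq_abs, abs_of_pos (mw_pos γ s)]
  have h1 := ce_le (by linarith : 0 ≤ γ) s
  calc mw γ s 
      ≤ Real.exp (4*s) * (2 ^ γ * Real.exp (-γ * |s|)) := by
        unfold mw; gcongr
    _ = 2 ^ γ * Real.exp (4*s + -γ*|s|) := by rw [Real.exp_add]; ring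
    _ ≤ 2 ^ γ * Real.exp (-(1/2) * |s|) := by
        gcongr
        nlinarith [abs_nonneg s, le_abs_self s]

lemma mw_mul_int {γ : ℝ} (hγ : 9 / 2 ≤ γ) {f : ℝ → ℝ} (hf : Bdd f) :
    Integrable (fun s => mw γ s * f s) := by
  obtain ⟨mf, C, hC⟩ := hf
  exact (mw_int0 hγ).mul_bdd (c := C) mf.aestronglyMeasurable
    (Filter.Eventually.of_forall hC)

def Mfm {γ : ℝ} (hγ : 9 / 2 ≤ γ) : XS →ₗ[ℝ] ℝ where
  toFun v := ∫ s, mw γ s * v.f0 s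
  map_add' v w := by
    simp only [XS.f0_add, mul_add]
    exact integral_add (mw_mul_int hγ v.g0.bdd) (mw_mul_int hγ w.g0.bdd)
  map_smul' c v := by
    simp only [XS.f0_smul, mul_left_comm, smul_eq_mul, RingHom.id_apply]
    exact integral_const_mul _ _

lemma Mfm_apply {γ : ℝ} (hγ : 9 / 2 ≤ γ) (v : XS) : Mfm hγ v = ∫ s, mw γ s * v.f0 s := rfl

lemma Mfm_z {γ : ℝ} (hγ : 9 / 2 ≤ γ) (hγ1 : 1 ≤ γ) : Mfm hγ (zX hγ1) ≠ 0 := by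
  have hi := mw_mul_int hγ (zX hγ1).g0.bdd
  have h1 := integral_neg_eq_self (fun s => mw γ s * (zX hγ1).f0 s) volume
  have hi' : Integrable (fun s => mw γ (-s) * (zX hγ1).f0 (-s)) := hi.comp_neg
  have h2 : 0 < ∫ s, (mw γ s * (zX hγ1).f0 s + mw γ (-s) * (zX hγ1).f0 (-s)) := by
    have hpt : ∀ s, mw γ s * (zX hγ1).f0 s + mw γ (-s) * (zX hγ1).f0 (-s)
        = 2 * (Real.sinh (4*s) * Real.tanh s) * ce γ s ^ 2 := by
      intro s
      have : ce γ (-s) = ce γ s := by simp [ce]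
      simp only [zX_f0, mw, this, Real.tanh_neg, Real.sinh_eq]
      rw [show 4 * -s = -(4*s) by ring]
      ring
    have hsgn : ∀ s, s ≠ 0 → 0 < Real.sinh (4*s) * Real.tanh s := by
      intro s hs
      rcases lt_or_gt_of_ne hs with h | h
      · have a : Real.sinh (4*s) < 0 := Real.sinh_neg_iff.2 (by linarith)
        have b : Real.tanh s < 0 := by simpa using th_mono h
        exact mul_pos_of_neg_of_neg a b
      · have a : 0 < Real.sinh (4*s) := Real.sinh_pos_iff.2 (by linarith)
        have b : 0 < Real.tanh s := by simpa using th_mono h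
        exact mul_pos a b
    rw [integral_pos_iff_support_of_nonneg]
    · have : Set.Ioi (0:ℝ) ⊆ Function.support
          (fun s => mw γ s * (zX hγ1).f0 s + mw γ (-s) * (zX hγ1).f0 (-s)) := by
        intro s hs
        rw [Function.mem_support, hpt]
        have := hsgn s (ne_of_gt hs)
        have := ce_pos γ s
        positivity
      refine lt_of_lt_of_le ?_ (measure_mono this)
      simp
    · intro s
      simp only [Pi.zero_apply]
      rw [hpt]
      by_cases hs : s = 0
      · simp [hs]
      · have := hsgn s hs
        positivity
    · exact hi.add hi'
  rw [integral_add hi hi', h1] at h2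
  intro h
  rw [Mfm_apply] at h
  linarith

/-! ### Splitting at a large radius -/

def spl (s1 K κ L μ : ℝ) (f : ℝ → ℝ) (s : ℝ) : ℝ :=
  if s1 ≤ s then f s - L * Real.exp (-μ * (s - s1)) else K * Real.exp (κ * (s - s1))

lemma spl_good {s1 K κ L μ : ℝ} {f : ℝ → ℝ} (hs : 0 ≤ s1) (hκ : 1 ≤ κ) (hμ : 1 ≤ μ) (hf : Good f) :
    Good (spl s1 K κ L μ f) := by
  obtain ⟨mf, C, hC⟩ := hf
  refine ⟨Measurable.ite measurableSet_Ici (by fun_prop) (by fun_prop),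
    C + (|L| + |K|) * Real.exp s1, fun s => ?_⟩
  have hC0 : 0 ≤ C * Real.exp (-|s|) := (abs_nonneg _).trans (hC s)
  unfold spl
  split_ifs with h
  · have e1 : Real.exp (-μ * (s - s1)) ≤ Real.exp s1 * Real.exp (-|s|) := by
      rw [← Real.exp_add, abs_of_nonneg (hs.trans h)]
      apply Real.exp_le_exp.2
      nlinarith
    calc |f s - L * Real.exp (-μ * (s - s1))| ≤ |f s| + |L| * Real.exp (-μ * (s - s1)) := by
          refine (abs_sub _ _).trans_eq ?_
          rw [abs_mul, abs_of_pos (Real.exp_pos _)]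
      _ ≤ C * Real.exp (-|s|) + |L| * (Real.exp s1 * Real.exp (-|s|)) := by
          gcongr
          exact hC s
      _ ≤ _ := by
          have : 0 ≤ |K| * Real.exp s1 * Real.exp (-|s|) := by positivity
          nlinarith
  · push Not at h
    have e1 : Real.exp (κ * (s - s1)) ≤ Real.exp s1 * Real.exp (-|s|) := by
      rw [← Real.exp_add]
      apply Real.exp_le_exp.2
      have : |s| ≤ 2 * s1 - s := by rw [abs_le]; constructor <;> linarith
      nlinarith
    calc |K * Real.exp (κ * (s - s1))| = |K| * Real.exp (κ * (s - s1)) := by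
          rw [abs_mul, abs_of_pos (Real.exp_pos _)]
      _ ≤ |K| * (Real.exp s1 * Real.exp (-|s|)) := by gcongr
      _ ≤ _ := by
          have : 0 ≤ |L| * Real.exp s1 * Real.exp (-|s|) := by positivity
          nlinarith

lemma spl_cont {s1 K κ L μ : ℝ} {f : ℝ → ℝ} (hf : Continuous f) (hK : K = f s1 - L) :
    Continuous (spl s1 K κ L μ f) := by
  unfold spl
  refine Continuous.if_le (by fun_prop) (by fun_prop) continuous_const continuous_id ?_
  rintro s rfl
  simp [hK]

lemma spl_deriv {s1 K κ L μ : ℝ} {f f' : ℝ → ℝ}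
    (hf : ∀ s, HasDerivWithinAt f (f' s) (Set.Ioi s) s) (s : ℝ) :
    HasDerivWithinAt (spl s1 K κ L μ f) (spl s1 (κ * K) κ (-μ * L) μ f' s) (Set.Ioi s) s := by
  by_cases h : s1 ≤ s
  · have e : HasDerivAt (fun t => L * Real.exp (-μ * (t - s1)))
        (-μ * L * Real.exp (-μ * (s - s1))) s := by
      have := (((((hasDerivAt_id s).sub_const s1).const_mul (-μ)).exp).const_mul L)
      refine this.congr_deriv ?_
      simp; ring
    have := (hf s).sub e.hasDerivWithinAt
    have e2 : spl s1 (κ * K) κ (-μ * L) μ f' s = f' s - -μ * L * Real.exp (-μ * (s - s1)) := by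
      simp [spl, h]
    rw [e2]
    refine this.congr (fun t ht => ?_) ?_
    · simp [spl, h.trans (le_of_lt ht)]
    · simp [spl, h]
  · have e : HasDerivAt (fun t => K * Real.exp (κ * (t - s1)))
        (κ * K * Real.exp (κ * (s - s1))) s := by
      have := (((((hasDerivAt_id s).sub_const s1).const_mul κ).exp).const_mul K)
      refine this.congr_deriv ?_
      simp; ring
    have e2 : spl s1 (κ * K) κ (-μ * L) μ f' s = κ * K * Real.exp (κ * (s - s1)) := by
      simp [spl, h]
    rw [e2]
    refine (e.congr_of_eventuallyEq ?_).hasDerivWithinAt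
    filter_upwards [eventually_lt_nhds (not_le.1 h)] with t ht
    simp [spl, not_le.2 ht]

def hK (γ s1 : ℝ) (v : XS) : ℝ := (v.f1 s1 + (γ + 2) * v.f0 s1) / (2 * γ + 2)

lemma hmem {γ s1 : ℝ} (hγ : 1 ≤ γ) (hs : 0 ≤ s1) (v : XS) :
    ((spl s1 (hK γ s1 v) γ (v.f0 s1 - hK γ s1 v) (γ + 2) v.f0,
      spl s1 (γ * hK γ s1 v) γ (-(γ + 2) * (v.f0 s1 - hK γ s1 v)) (γ + 2) v.f1,
      spl s1 (γ * (γ * hK γ s1 v)) γ (-(γ + 2) * (-(γ + 2) * (v.f0 s1 - hK γ s1 v))) (γ + 2) v.f2) :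
      (ℝ → ℝ) × (ℝ → ℝ) × (ℝ → ℝ)) ∈ XM := by
  have h2 : (1:ℝ) ≤ γ + 2 := by linarith
  refine ⟨spl_cont v.c0 (by ring), spl_cont v.c1 ?_, spl_deriv v.d0, spl_deriv v.d1,
    spl_good hs hγ h2 v.g0, spl_good hs hγ h2 v.g1, spl_good hs hγ h2 v.g2⟩
  have : 2 * γ + 2 ≠ 0 := by linarith
  unfold hK
  field_simp
  ring

def hX {γ s1 : ℝ} (hγ : 1 ≤ γ) (hs : 0 ≤ s1) (v : XS) : XS := ⟨_, hmem hγ hs v⟩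

lemma hX_f0 {γ s1 : ℝ} (hγ : 1 ≤ γ) (hs : 0 ≤ s1) (v : XS) :
    (hX hγ hs v).f0 = spl s1 (hK γ s1 v) γ (v.f0 s1 - hK γ s1 v) (γ + 2) v.f0 := rfl

lemma hX_D {γ s1 : ℝ} (hγ : 1 ≤ γ) (hs : 0 ≤ s1) (v : XS) (s : ℝ) :
    (hX hγ hs v).D γ s = if s1 ≤ s then v.D γ s else 0 := by
  change spl s1 (γ * (γ * hK γ s1 v)) γ (-(γ + 2) * (-(γ + 2) * (v.f0 s1 - hK γ s1 v)))
    (γ + 2) v.f2 s +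
    2 * spl s1 (γ * hK γ s1 v) γ (-(γ + 2) * (v.f0 s1 - hK γ s1 v)) (γ + 2) v.f1 s
    - γ * (γ + 2) * spl s1 (hK γ s1 v) γ (v.f0 s1 - hK γ s1 v) (γ + 2) v.f0 s = _
  unfold spl
  split_ifs with h
  · rw [XS.D]; ring
  · ring

lemma XS.D_sub (γ : ℝ) (v w : XS) (s : ℝ) : (v - w).D γ s = v.D γ s - w.D γ s := by
  rw [sub_eq_add_neg, ← neg_one_smul ℝ w, XS.D_add, XS.D_smul]; ring

lemma Efm_symm (γ : ℝ) (v w : XS) : Efm γ v w = Efm γ w v := by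
  simp only [Efm_apply, mul_comm]

lemma Pfm_symm (v w : XS) : Pfm v w = Pfm w v := by
  simp only [Pfm_apply]; congr 1; ext s; ring

lemma E_hh {γ s1 : ℝ} (hγ : 1 ≤ γ) (hs : 0 ≤ s1) (v : XS) :
    Efm γ (hX hγ hs v) (hX hγ hs v) = ∫ s in Set.Ici s1, (v.D γ s) ^ 2 := by
  rw [Efm_apply, ← integral_indicator measurableSet_Ici]
  congr 1; ext s
  simp only [hX_D, Set.indicator, Set.mem_Ici]
  split_ifs <;> ring

lemma E_uh {γ s1 : ℝ} (hγ : 1 ≤ γ) (hs : 0 ≤ s1) (v : XS) :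
    Efm γ (v - hX hγ hs v) (hX hγ hs v) = 0 := by
  rw [Efm_apply, ← integral_zero ℝ ℝ]
  congr 1; ext s
  simp only [XS.D_sub, hX_D]
  split_ifs <;> ring

lemma E_yh {γ s1 : ℝ} (hγ : 1 ≤ γ) (hs : 0 ≤ s1) (y v : XS) :
    Efm γ y (hX hγ hs v) = Efm γ (hX hγ hs y) (hX hγ hs v) := by
  simp only [Efm_apply]
  congr 1; ext s
  simp only [hX_D]
  split_ifs <;> ring

lemma E_uu {γ s1 : ℝ} (hγ : 1 ≤ γ) (hs : 0 ≤ s1) (v : XS) :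
    Efm γ (v - hX hγ hs v) (v - hX hγ hs v) = ∫ s in Set.Iio s1, (v.D γ s) ^ 2 := by
  rw [Efm_apply, ← integral_indicator measurableSet_Iio]
  congr 1; ext s
  simp only [XS.D_sub, hX_D, Set.indicator, Set.mem_Iio]
  by_cases h : s1 ≤ s
  · simp [h, not_lt.2 h]
  · simp [h, not_le.1 h]; ring

lemma sobolev' {γ : ℝ} (hγ : 1 ≤ γ) (v : XS) (s : ℝ) : |v.f0 s| ≤ Real.sqrt (Efm γ v v) :=
  Real.abs_le_sqrt (sobolev hγ v s)

lemma h_bound {γ s1 : ℝ} (hγ : 1 ≤ γ) (hs : 0 ≤ s1) (v : XS) (s : ℝ) :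
    |(hX hγ hs v).f0 s| ≤ Real.sqrt (Efm γ (hX hγ hs v) (hX hγ hs v))
      * Real.exp ((s - s1) / 4) := by
  have hb := sobolev' hγ (hX hγ hs v)
  set R := Real.sqrt (Efm γ (hX hγ hs v) (hX hγ hs v))
  have hR : 0 ≤ R := Real.sqrt_nonneg _
  by_cases h : s1 ≤ s
  · have : 1 ≤ Real.exp ((s - s1) / 4) := Real.one_le_exp (by linarith)
    exact (hb s).trans (le_mul_of_one_le_right hR this)
  · have h1 : |hK γ s1 v| ≤ R := by
      have := hb s1
      rw [hX_f0] at this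
      simpa [spl] using this
    have h2 : (hX hγ hs v).f0 s = hK γ s1 v * Real.exp (γ * (s - s1)) := by
      rw [hX_f0]; simp [spl, h]
    rw [h2, abs_mul, abs_of_pos (Real.exp_pos _)]
    push Not at h
    gcongr
    nlinarith

lemma sg2_int : Integrable (fun s => sg s ^ 2 * Real.exp (s / 4)) := by
  refine ((integrable_exp_neg_mul_abs (a := 1) (by norm_num)).const_mul 4).mono'
    (((cont_sg.pow 2).mul (by fun_prop)).aestronglyMeasurable)
    (Filter.Eventually.of_forall fun s => ?_)
  have h0 := sg_pos s
  rw [Real.norm_eq_abs, abs_of_pos (by positivity)]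
  have h1 : sg s ^ 2 ≤ 4 * Real.exp (-2 * |s|) := by
    have := sg_le s
    have := sg_le_exp s
    nlinarith
  calc sg s ^ 2 * Real.exp (s / 4) ≤ 4 * Real.exp (-2 * |s|) * Real.exp (s / 4) := by gcongr
    _ = 4 * Real.exp (-2 * |s| + s / 4) := by rw [Real.exp_add]; ring
    _ ≤ 4 * Real.exp (-1 * |s|) := by
      gcongr
      nlinarith [le_abs_self s, abs_nonneg s]

def Jc : ℝ := ∫ s, sg s ^ 2 * Real.exp (s / 4)
def Ic (γ : ℝ) : ℝ := ∫ s, mw γ s * Real.exp (s / 4)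

lemma Jc_nonneg : 0 ≤ Jc := integral_nonneg fun s => by positivity
lemma Ic_nonneg (γ : ℝ) : 0 ≤ Ic γ :=
  integral_nonneg fun s => (mul_pos (mw_pos γ s) (Real.exp_pos _)).le

lemma P_bound {s1 A K : ℝ} (a b : XS) (ha : ∀ s, |a.f0 s| ≤ A) (hA : 0 ≤ A)
    (hb : ∀ s, |b.f0 s| ≤ K * Real.exp ((s - s1) / 4)) :
    |Pfm a b| ≤ A * K * (Real.exp (-s1 / 4) * Jc) := by
  rw [Pfm_apply, Jc, ← Real.norm_eq_abs, ← integral_const_mul, ← integral_const_mul]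
  refine norm_integral_le_of_norm_le ((sg2_int.const_mul _).const_mul _)
    (Filter.Eventually.of_forall fun s => ?_)
  rw [Real.norm_eq_abs, abs_mul, abs_mul, abs_of_nonneg (sq_nonneg (sg s))]
  have e : Real.exp ((s - s1) / 4) = Real.exp (-s1 / 4) * Real.exp (s / 4) := by
    rw [← Real.exp_add]; ring_nf
  calc sg s ^ 2 * |a.f0 s| * |b.f0 s| ≤ sg s ^ 2 * A * (K * Real.exp ((s - s1) / 4)) := by
        gcongr
        · exact ha s
        · exact hb s
    _ = _ := by rw [e]; ring

lemma M_bound {γ : ℝ} (hγ : 9 / 2 ≤ γ) {s1 K : ℝ} (b : XS)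
    (hb : ∀ s, |b.f0 s| ≤ K * Real.exp ((s - s1) / 4)) :
    |Mfm hγ b| ≤ K * (Real.exp (-s1 / 4) * Ic γ) := by
  rw [Mfm_apply, Ic, ← Real.norm_eq_abs, ← integral_const_mul, ← integral_const_mul]
  refine norm_integral_le_of_norm_le (((mw_int hγ).const_mul _).const_mul _)
    (Filter.Eventually.of_forall fun s => ?_)
  rw [Real.norm_eq_abs, abs_mul, abs_of_pos (mw_pos γ s)]
  have e : Real.exp ((s - s1) / 4) = Real.exp (-s1 / 4) * Real.exp (s / 4) := by
    rw [← Real.exp_add]; ring_nf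
  calc mw γ s * |b.f0 s| ≤ mw γ s * (K * Real.exp ((s - s1) / 4)) := by
        gcongr
        · exact (mw_pos γ s).le
        · exact hb s
    _ = _ := by rw [e]; ring

lemma M_bound0 {γ : ℝ} (hγ : 9 / 2 ≤ γ) (b : XS) :
    (Mfm hγ b) ^ 2 ≤ (∫ s, mw γ s) ^ 2 * Efm γ b b := by
  have h1 : |Mfm hγ b| ≤ (∫ s, mw γ s) * Real.sqrt (Efm γ b b) := by
    rw [Mfm_apply, ← Real.norm_eq_abs, ← integral_mul_const]
    refine norm_integral_le_of_norm_le ((mw_int0 hγ).mul_const _)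
      (Filter.Eventually.of_forall fun s => ?_)
    rw [Real.norm_eq_abs, abs_mul, abs_of_pos (mw_pos γ s)]
    gcongr
    · exact (mw_pos γ s).le
    · exact sobolev' (by linarith) b s
  have h2 := pow_le_pow_left₀ (abs_nonneg _) h1 2
  rwa [sq_abs, mul_pow, Real.sq_sqrt (Efm_nonneg γ b)] at h2

lemma E_tail {γ : ℝ} (hγ : 1 ≤ γ) (y : XS) : ∃ B : ℝ, 0 ≤ B ∧ ∀ (s1 : ℝ) (hs : 0 ≤ s1),
    Efm γ (hX hγ hs y) (hX hγ hs y) ≤ B * Real.exp (-s1) := by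
  obtain ⟨-, C, hC⟩ := y.gD γ
  have hI : 0 ≤ ∫ s : ℝ, Real.exp (-|s|) := integral_nonneg fun s => (Real.exp_pos _).le
  refine ⟨C ^ 2 * ∫ s : ℝ, Real.exp (-|s|), by positivity, fun s1 hs => ?_⟩
  rw [Efm_apply, mul_right_comm, ← integral_const_mul]
  refine integral_mono ((((hX hγ hs y).gD γ).mul ((hX hγ hs y).gD γ)).integrable)
    (integrable_expabs.const_mul _) fun s => ?_
  simp only [hX_D]
  split_ifs with h
  · have h1 : y.D γ s * y.D γ s ≤ (C * Real.exp (-|s|)) ^ 2 := by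
      rw [← sq, ← sq_abs]
      exact pow_le_pow_left₀ (abs_nonneg _) (hC s) 2
    have h2 : Real.exp (-|s|) ≤ Real.exp (-s1) := by
      rw [abs_of_nonneg (hs.trans h)]; gcongr
    calc _ ≤ _ := h1
      _ = C ^ 2 * Real.exp (-|s|) * Real.exp (-|s|) := by ring
      _ ≤ _ := by gcongr
  · rw [mul_zero]; positivity

lemma E_CS (γ : ℝ) (a b : XS) : (Efm γ a b) ^ 2 ≤ Efm γ a a * Efm γ b b := by
  have h0 := Efm_nonneg γ
  by_cases hb : Efm γ b b = 0
  · have : ∀ t : ℝ, 0 ≤ Efm γ a a + 2 * t * Efm γ a b := by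
      intro t
      have := h0 (a + t • b)
      simp only [map_add, map_smul, LinearMap.add_apply, LinearMap.smul_apply, smul_eq_mul,
        hb, Efm_symm γ b a] at this
      linarith
    have h1 : Efm γ a b = 0 := by
      by_contra hne
      have := this (-(Efm γ a a + 1) / (2 * Efm γ a b))
      have e : 2 * (-(Efm γ a a + 1) / (2 * Efm γ a b)) * Efm γ a b = -(Efm γ a a + 1) := by
        field_simp
      linarith
    simp [h1, hb]
  · have hp : 0 < Efm γ b b := lt_of_le_of_ne (h0 b) (Ne.symm hb)
    have := h0 (a - (Efm γ a b / Efm γ b b) • b)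
    simp only [map_sub, map_smul, LinearMap.sub_apply, LinearMap.smul_apply, smul_eq_mul,
        Efm_symm γ b a] at this
    have e : Efm γ a a - Efm γ a b / Efm γ b b * Efm γ a b - Efm γ a b / Efm γ b b *
      (Efm γ a b - Efm γ a b / Efm γ b b * Efm γ b b) = Efm γ a a - (Efm γ a b) ^ 2 / Efm γ b b := by
      field_simp; ring
    rw [e] at this
    have h3 : (Efm γ a b) ^ 2 / Efm γ b b ≤ Efm γ a a := by linarith
    rwa [div_le_iff₀ hp] at h3

def lam1 (γ : ℝ) : ℝ := (γ + 1) * (γ + 2) * (γ + 3) * (γ + 4)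

def Qfm (γ : ℝ) : XS →ₗ[ℝ] XS →ₗ[ℝ] ℝ := Efm γ - lam1 γ • Pfm

lemma Qfm_apply (γ : ℝ) (v w : XS) : Qfm γ v w = Efm γ v w - lam1 γ * Pfm v w := rfl

lemma small {γ : ℝ} (hγ : 9 / 2 ≤ γ) (hγ1 : 1 ≤ γ) (y : XS) {η : ℝ} (hη : 0 < η) :
    ∃ s1 : ℝ, ∃ hs : 0 ≤ s1, ∀ v : XS,
      (Mfm hγ (hX hγ1 hs v)) ^ 2 ≤ η * Efm γ (hX hγ1 hs v) (hX hγ1 hs v) ∧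
      (Qfm γ y (hX hγ1 hs v)) ^ 2 ≤ η * Efm γ (hX hγ1 hs v) (hX hγ1 hs v) ∧
      |Pfm (v - hX hγ1 hs v) (hX hγ1 hs v)| ≤ η *
        (Efm γ (v - hX hγ1 hs v) (v - hX hγ1 hs v) + Efm γ (hX hγ1 hs v) (hX hγ1 hs v)) ∧
      |Pfm (hX hγ1 hs v) (hX hγ1 hs v)| ≤ η * Efm γ (hX hγ1 hs v) (hX hγ1 hs v) := by
  obtain ⟨B, hB0, hB⟩ := E_tail hγ1 y
  have hJ := Jc_nonneg
  have hI := Ic_nonneg γ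
  set Y := Real.sqrt (Efm γ y y)
  have hY : 0 ≤ Y := Real.sqrt_nonneg _
  set Z : ℝ := Ic γ ^ 2 + 2 * B + 2 * (lam1 γ * Y * Jc) ^ 2 + Jc with hZ
  have hZ0 : 0 ≤ Z := by positivity
  have lim : Filter.Tendsto (fun s1 : ℝ => Real.exp (-s1 / 4) * Z) Filter.atTop (nhds 0) := by
    have h1 : Filter.Tendsto (fun s1 : ℝ => -s1 / 4) Filter.atTop Filter.atBot :=
      Filter.tendsto_neg_atTop_atBot.atBot_div_const (by norm_num)
    simpa using (Real.tendsto_exp_atBot.comp h1).mul_const Z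
  obtain ⟨s1, hs, hlt⟩ := ((Filter.eventually_ge_atTop (0:ℝ)).and
    (lim.eventually (gt_mem_nhds hη))).exists
  refine ⟨s1, hs, fun v => ?_⟩
  have hBy := hB s1 hs
  set t := Real.exp (-s1 / 4) with ht
  have ht0 : 0 < t := Real.exp_pos _
  have ht1 : t ≤ 1 := Real.exp_le_one_iff.2 (by linarith)
  have ht2 : t ^ 2 ≤ t := by nlinarith
  have ht4 : Real.exp (-s1) ≤ t := Real.exp_le_exp.2 (by linarith)
  have hb := h_bound hγ1 hs v
  have hM := M_bound hγ _ hb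
  have hPu := P_bound (v - hX hγ1 hs v) _ (sobolev' hγ1 _) (Real.sqrt_nonneg _) hb
  have hPh := P_bound (hX hγ1 hs v) _ (sobolev' hγ1 _) (Real.sqrt_nonneg _) hb
  have hPy := P_bound y _ (sobolev' hγ1 y) hY hb
  have hEy := E_CS γ (hX hγ1 hs y) (hX hγ1 hs v)
  rw [← E_yh] at hEy
  have hH := Efm_nonneg γ (hX hγ1 hs v)
  have hA := Efm_nonneg γ (v - hX hγ1 hs v)
  set h := hX hγ1 hs v
  set u := v - h
  set H := Efm γ h h
  set A := Efm γ u u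
  have sH := Real.sq_sqrt hH
  have sA := Real.sq_sqrt hA
  set rH := Real.sqrt H
  set rA := Real.sqrt A
  have rH0 : 0 ≤ rH := Real.sqrt_nonneg _
  have rA0 : 0 ≤ rA := Real.sqrt_nonneg _
  have c1 : t * Ic γ ^ 2 ≤ η := by
    refine le_trans ?_ hlt.le
    gcongr
    have : 0 ≤ 2 * B + 2 * (lam1 γ * Y * Jc) ^ 2 + Jc := by positivity
    linarith
  have c2 : t * (2 * B + 2 * (lam1 γ * Y * Jc) ^ 2) ≤ η := by
    refine le_trans ?_ hlt.le
    gcongr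
    have : 0 ≤ Ic γ ^ 2 := by positivity
    linarith
  have c3 : t * Jc ≤ η := by
    refine le_trans ?_ hlt.le
    gcongr
    have : 0 ≤ Ic γ ^ 2 + 2 * B + 2 * (lam1 γ * Y * Jc) ^ 2 := by positivity
    linarith
  refine ⟨?_, ?_, ?_, ?_⟩
  · have h2 := pow_le_pow_left₀ (abs_nonneg _) hM 2
    rw [sq_abs] at h2
    calc _ ≤ _ := h2
      _ = t ^ 2 * Ic γ ^ 2 * H := by rw [← sH]; ring
      _ ≤ t * Ic γ ^ 2 * H := by gcongr
      _ ≤ η * H := by gcongr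
  · have h2 := pow_le_pow_left₀ (abs_nonneg _) hPy 2
    rw [sq_abs] at h2
    have h3 : (Efm γ y h) ^ 2 ≤ B * t * H := by
      refine hEy.trans ?_
      gcongr
      exact hBy.trans (by gcongr)
    have h4 : (lam1 γ * Pfm y h) ^ 2 ≤ (lam1 γ * Y * Jc) ^ 2 * t * H := by
      calc (lam1 γ * Pfm y h) ^ 2 = lam1 γ ^ 2 * (Pfm y h) ^ 2 := by ring
        _ ≤ lam1 γ ^ 2 * (Y * rH * (t * Jc)) ^ 2 := by gcongr
        _ = (lam1 γ * Y * Jc) ^ 2 * t ^ 2 * H := by rw [← sH]; ring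
        _ ≤ (lam1 γ * Y * Jc) ^ 2 * t * H := by gcongr
    rw [Qfm_apply]
    calc (Efm γ y h - lam1 γ * Pfm y h) ^ 2
        ≤ 2 * (Efm γ y h) ^ 2 + 2 * (lam1 γ * Pfm y h) ^ 2 := by
          nlinarith [sq_nonneg (Efm γ y h + lam1 γ * Pfm y h)]
      _ ≤ 2 * (B * t * H) + 2 * ((lam1 γ * Y * Jc) ^ 2 * t * H) := by gcongr
      _ = t * (2 * B + 2 * (lam1 γ * Y * Jc) ^ 2) * H := by ring
      _ ≤ η * H := by gcongr
  · refine hPu.trans ?_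
    have : rA * rH ≤ A + H := by nlinarith [sq_nonneg (rA - rH)]
    calc rA * rH * (t * Jc) ≤ (A + H) * η := by gcongr
      _ = _ := by ring
  · refine hPh.trans ?_
    calc rH * rH * (t * Jc) = H * (t * Jc) := by rw [← sH]; ring
      _ ≤ H * η := by gcongr
      _ = _ := by ring

def e0m : XS →ₗ[ℝ] ℝ where
  toFun v := v.f0 0
  map_add' _ _ := rfl
  map_smul' _ _ := rfl

def e1m : XS →ₗ[ℝ] ℝ where
  toFun v := v.f1 0
  map_add' _ _ := rfl
  map_smul' _ _ := rfl

set_option maxHeartbeats 1000000 in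
theorem oneD {γ : ℝ} (hγ : 9 / 2 ≤ γ) (y : XS) (hy : Qfm γ y y < 0) :
    ∃ c C s1 : ℝ, 0 < c ∧ c < 1 / 2 ∧ 0 < C ∧ ∀ v : XS,
      -C * ((Mfm hγ v) ^ 2 + (Qfm γ y v) ^ 2) ≤
      (1 - 2 * c) * (∫ s in Set.Iio s1, (v.D γ s) ^ 2) + c * (∫ s in Set.Ici s1, (v.D γ s) ^ 2)
        - lam1 γ * Pfm v v := by
  have hγ1 : 1 ≤ γ := by linarith
  have hlam : 0 < lam1 γ := by unfold lam1; positivity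
  have hz0 : (zX hγ1).f0 0 = 0 := by rw [zX_f0]; simp
  have hz1 : (zX hγ1).f1 0 ≠ 0 := by rw [zX_f1]; simpa using (ce_pos γ 0).ne'
  obtain ⟨δ, C, hδ, hC, hco⟩ := abstract_coercive (Efm γ) (Qfm γ) (Efm_symm γ)
    (fun v w => by rw [Qfm_apply, Qfm_apply, Efm_symm, Pfm_symm]) (Efm_nonneg γ) y (zX hγ1)
    e0m e1m (Mfm hγ) (fun v => zX_ker hγ1 v) hz0 hz1 (Mfm_z hγ hγ1)
    (d := 4 / (γ ^ 2 + 5 * γ + 8)) (by positivity)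
    (fun v h0 h1 => by
      have := Lplus_clamped hγ1 v h0 h1
      rw [Qfm_apply, lam1]
      have hp : 0 < γ ^ 2 + 5 * γ + 8 := by positivity
      have h5 : 4 / (γ ^ 2 + 5 * γ + 8) * Efm γ v v
        = Efm γ v v - (γ ^ 2 + 5 * γ + 4) / (γ ^ 2 + 5 * γ + 8) * Efm γ v v := by
        field_simp; ring
      have h6 : (γ + 1) * (γ + 2) * (γ + 3) * (γ + 4) * Pfm v v =
        (γ ^ 2 + 5 * γ + 4) / (γ ^ 2 + 5 * γ + 8) *
          ((γ + 2) * (γ + 3) * (γ ^ 2 + 5 * γ + 8) * Pfm v v) := by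
        field_simp; ring
      rw [h5, h6]
      have : (γ ^ 2 + 5 * γ + 4) / (γ ^ 2 + 5 * γ + 8) *
          ((γ + 2) * (γ + 3) * (γ ^ 2 + 5 * γ + 8) * Pfm v v) ≤
          (γ ^ 2 + 5 * γ + 4) / (γ ^ 2 + 5 * γ + 8) * Efm γ v v := by gcongr
      linarith) hy (M_bound0 hγ)
  set c := min (δ / 4) (1 / 4) with hc
  have hc0 : 0 < c := lt_min (by linarith) (by norm_num)
  have hc1 : c ≤ δ / 4 := min_le_left _ _
  have hc2 : c ≤ 1 / 4 := min_le_right _ _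
  have hden : 0 < 4 * C + 4 * lam1 γ := by positivity
  set η := c / (4 * C + 4 * lam1 γ) with hη
  have hη0 : 0 < η := by positivity
  have hη1 : (4 * C + 4 * lam1 γ) * η = c := by rw [hη]; field_simp
  obtain ⟨s1, hs, hsm⟩ := small hγ hγ1 y hη0
  refine ⟨c, 2 * C, s1, hc0, by linarith, by linarith, fun v => ?_⟩
  obtain ⟨b1, b2, b3, b4⟩ := hsm v
  rw [← E_uu hγ1 hs, ← E_hh hγ1 hs]
  have hH := Efm_nonneg γ (hX hγ1 hs v)
  have hA := Efm_nonneg γ (v - hX hγ1 hs v)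
  set h := hX hγ1 hs v
  set u := v - h with hu
  have hv : v = u + h := by rw [hu]; abel
  have hcu := hco u
  have m1 : Mfm hγ v = Mfm hγ u + Mfm hγ h := by rw [hv, map_add]
  have m2 : Qfm γ y v = Qfm γ y u + Qfm γ y h := by rw [hv, map_add]
  have m3 : Pfm v v = Pfm u u + 2 * Pfm u h + Pfm h h := by
    rw [hv]
    simp only [map_add, LinearMap.add_apply, Pfm_symm h u]
    ring
  rw [Qfm_apply γ u u] at hcu
  clear_value u h
  have q1 : (Mfm hγ u) ^ 2 ≤ 2 * (Mfm hγ v) ^ 2 + 2 * (Mfm hγ h) ^ 2 := by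
    rw [m1]; nlinarith [sq_nonneg (Mfm hγ u + 2 * Mfm hγ h)]
  have q2 : (Qfm γ y u) ^ 2 ≤ 2 * (Qfm γ y v) ^ 2 + 2 * (Qfm γ y h) ^ 2 := by
    rw [m2]; nlinarith [sq_nonneg (Qfm γ y u + 2 * Qfm γ y h)]
  rw [m3]
  have b3' := (abs_le.1 b3).2
  have b4' := (abs_le.1 b4).2
  set A := Efm γ u u
  set H := Efm γ h h
  have q3 : C * ((Mfm hγ u) ^ 2 + (Qfm γ y u) ^ 2) ≤
      C * (2 * (Mfm hγ v) ^ 2 + 2 * (Qfm γ y v) ^ 2 + 4 * (η * H)) :=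
    mul_le_mul_of_nonneg_left (by linarith) hC.le
  have q4 := mul_le_mul_of_nonneg_left b3' hlam.le
  have q5 := mul_le_mul_of_nonneg_left b4' hlam.le
  have q6 : 4 * C * η * H + 4 * lam1 γ * η * H = c * H := by rw [← hη1]; ring
  have q7 : 4 * lam1 γ * η ≤ c := by
    have : 0 ≤ C * η := by positivity
    linarith
  have q8 : 4 * lam1 γ * η * A ≤ c * A := by gcongr
  have q9 : c * A ≤ δ / 4 * A := by gcongr
  have q10 : 0 ≤ lam1 γ * η * H := by positivity
  have q11 : 0 ≤ δ * A := by positivity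
  linarith

/-! ### Radial profiles -/

lemma good_exp_schwartz {α : ℝ} (hα : 1 ≤ α) (f : SchwartzMap ℝ ℝ) :
    Good (fun s => Real.exp (α * s) * f (Real.exp s)) := by
  obtain ⟨k, hk⟩ := exists_nat_ge (α + 1)
  obtain ⟨C0, hC0, h0⟩ := f.decay 0 0
  obtain ⟨C1, hC1, h1⟩ := f.decay k 0
  refine ⟨by have := f.continuous; fun_prop, C0 + C1, fun s => ?_⟩
  have h0' := h0 (Real.exp s)
  have h1' := h1 (Real.exp s)
  simp only [pow_zero, one_mul, norm_iteratedFDeriv_zero, Real.norm_eq_abs,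
    abs_of_pos (Real.exp_pos s)] at h0' h1'
  rw [abs_mul, abs_of_pos (Real.exp_pos _)]
  rcases le_total s 0 with hs | hs
  · calc Real.exp (α * s) * |f (Real.exp s)| ≤ Real.exp (-|s|) * C0 := by
          gcongr
          rw [abs_of_nonpos hs]
          nlinarith
      _ ≤ _ := by nlinarith [Real.exp_pos (-|s|)]
  · have e : Real.exp (α * s) ≤ Real.exp (-|s|) * Real.exp s ^ k := by
      rw [← Real.exp_nat_mul, ← Real.exp_add, abs_of_nonneg hs]
      apply Real.exp_le_exp.2
      nlinarith
    calc Real.exp (α * s) * |f (Real.exp s)|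
        ≤ Real.exp (-|s|) * Real.exp s ^ k * |f (Real.exp s)| := by gcongr
      _ = Real.exp (-|s|) * (Real.exp s ^ k * |f (Real.exp s)|) := by ring
      _ ≤ Real.exp (-|s|) * C1 := by gcongr
      _ ≤ _ := by nlinarith [Real.exp_pos (-|s|)]

lemma exp_schwartz_deriv (α : ℝ) (f : SchwartzMap ℝ ℝ) (s : ℝ) :
    HasDerivAt (fun s => Real.exp (α * s) * f (Real.exp s))
      (α * (Real.exp (α * s) * f (Real.exp s))
        + Real.exp ((α + 1) * s) * SchwartzMap.derivCLM ℝ ℝ f (Real.exp s)) s := by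
  have h1 := (((hasDerivAt_id s).const_mul α).exp).mul
    ((f.hasDerivAt (Real.exp s)).comp s (Real.hasDerivAt_exp s))
  refine h1.congr_deriv ?_
  rw [SchwartzMap.derivCLM_apply, add_mul, Real.exp_add]
  simp
  ring

def pr0 (γ : ℝ) (f : SchwartzMap ℝ ℝ) (s : ℝ) : ℝ := Real.exp (γ * s) * f (Real.exp s)

lemma prof_mem {γ : ℝ} (hγ : 1 ≤ γ) (f : SchwartzMap ℝ ℝ) :
    ((pr0 γ f,
      fun s => γ * pr0 γ f s + pr0 (γ + 1) (SchwartzMap.derivCLM ℝ ℝ f) s,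
      fun s => γ * (γ * pr0 γ f s + pr0 (γ + 1) (SchwartzMap.derivCLM ℝ ℝ f) s)
        + ((γ + 1) * pr0 (γ + 1) (SchwartzMap.derivCLM ℝ ℝ f) s
          + pr0 (γ + 1 + 1) (SchwartzMap.derivCLM ℝ ℝ (SchwartzMap.derivCLM ℝ ℝ f)) s)) :
      (ℝ → ℝ) × (ℝ → ℝ) × (ℝ → ℝ)) ∈ XM := by
  have d0 := exp_schwartz_deriv γ f
  have d1 := exp_schwartz_deriv (γ + 1) (SchwartzMap.derivCLM ℝ ℝ f)
  have g0 := good_exp_schwartz hγ f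
  have g1 := good_exp_schwartz (by linarith : 1 ≤ γ + 1) (SchwartzMap.derivCLM ℝ ℝ f)
  have g2 := good_exp_schwartz (by linarith : 1 ≤ γ + 1 + 1)
    (SchwartzMap.derivCLM ℝ ℝ (SchwartzMap.derivCLM ℝ ℝ f))
  have d01 := fun s => ((d0 s).const_mul γ).add (d1 s)
  refine ⟨continuous_iff_continuousAt.2 fun s => (d0 s).continuousAt,
    continuous_iff_continuousAt.2 fun s => (d01 s).continuousAt,
    fun s => (d0 s).hasDerivWithinAt, fun s => (d01 s).hasDerivWithinAt, g0,
    (g0.const_mul γ).add g1,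
    (((g0.const_mul γ).add g1).const_mul γ).add ((g1.const_mul (γ + 1)).add g2)⟩

def prof {γ : ℝ} (hγ : 1 ≤ γ) (f : SchwartzMap ℝ ℝ) : XS := ⟨_, prof_mem hγ f⟩

lemma prof_f0 {γ : ℝ} (hγ : 1 ≤ γ) (f : SchwartzMap ℝ ℝ) (s : ℝ) :
    (prof hγ f).f0 s = Real.exp (γ * s) * f (Real.exp s) := rfl

/-- radial Laplacian -/
def lapG (N : ℕ) (f : SchwartzMap ℝ ℝ) (r : ℝ) : ℝ :=
  SchwartzMap.derivCLM ℝ ℝ (SchwartzMap.derivCLM ℝ ℝ f) r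
    + ((N : ℝ) - 1) * (SchwartzMap.derivCLM ℝ ℝ f r / r)

lemma prof_D {γ : ℝ} (hγ : 1 ≤ γ) {N : ℕ} (hN : (N : ℝ) = 2 * γ + 4) (f : SchwartzMap ℝ ℝ) (s : ℝ) :
    (prof hγ f).D γ s = Real.exp ((γ + 2) * s) * lapG N f (Real.exp s) := by
  have e1 : Real.exp ((γ + 2) * s) = Real.exp (γ * s) * Real.exp s ^ 2 := by
    rw [← Real.exp_nat_mul, ← Real.exp_add]; congr 1; push_cast; ring
  have e2 : Real.exp ((γ + 1) * s) = Real.exp (γ * s) * Real.exp s := by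
    rw [← Real.exp_add]; congr 1; ring
  have e3 : Real.exp ((γ + 1 + 1) * s) = Real.exp (γ * s) * Real.exp s ^ 2 := by
    rw [← e1]; congr 1; ring
  have h : (prof hγ f).D γ s = (γ * (γ * pr0 γ f s + pr0 (γ + 1) (SchwartzMap.derivCLM ℝ ℝ f) s)
        + ((γ + 1) * pr0 (γ + 1) (SchwartzMap.derivCLM ℝ ℝ f) s
          + pr0 (γ + 1 + 1) (SchwartzMap.derivCLM ℝ ℝ (SchwartzMap.derivCLM ℝ ℝ f)) s))
        + 2 * (γ * pr0 γ f s + pr0 (γ + 1) (SchwartzMap.derivCLM ℝ ℝ f) s)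
        - γ * (γ + 2) * pr0 γ f s := rfl
  rw [h, lapG, hN]
  simp only [pr0, e1, e2, e3]
  have := Real.exp_pos s
  field_simp
  ring

/-- strict positivity on profiles -/
lemma Lminus_strict {γ : ℝ} (hγ : 1 ≤ γ) (f : SchwartzMap ℝ ℝ)
    (h : Efm γ (prof hγ f) (prof hγ f)
      - γ * (γ + 1) * (γ + 2) * (γ + 3) * Pfm (prof hγ f) (prof hγ f) ≤ 0) :
    ∀ r, 0 < r → f r = 0 := by
  set v := prof hγ f with hv
  have h1 := (Lminus hγ v).trans h
  have hg : Good (fun s => v.f1 s + γ * Real.tanh s * v.f0 s) :=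
    v.g1.add (v.g0.bdd_mul ((Bdd.const γ).mul bdd_th))
  have hcont : Continuous (fun s => v.f1 s + γ * Real.tanh s * v.f0 s) :=
    v.c1.add ((continuous_const.mul cont_th).mul v.c0)
  have hnn : 0 ≤ fun s => sg s * (v.f1 s + γ * Real.tanh s * v.f0 s) ^ 2 := fun s => by
    have := sg_pos s
    simp only [Pi.zero_apply]
    positivity
  have hz : ∀ s, v.f1 s + γ * Real.tanh s * v.f0 s = 0 := by
    have h2 : ∫ s, sg s * (v.f1 s + γ * Real.tanh s * v.f0 s) ^ 2 = 0 :=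
      le_antisymm h1 (integral_nonneg hnn)
    rw [integral_eq_zero_iff_of_nonneg hnn ((hg.sq.bdd_mul bdd_sg).integrable)] at h2
    replace h2 := (Continuous.ae_eq_iff_eq volume (cont_sg.mul (hcont.pow 2))
      continuous_zero).1 h2
    intro s
    have h3 := congrFun h2 s
    simp only [Pi.zero_apply, Pi.mul_apply, Pi.pow_apply] at h3
    rcases mul_eq_zero.1 h3 with h4 | h4
    · exact absurd h4 (sg_pos s).ne'
    · exact pow_eq_zero_iff (two_ne_zero) |>.1 h4
  -- v * cosh^γ is constant
  have hder : ∀ s, HasDerivWithinAt (fun t => v.f0 t * ce (-γ) t) 0 (Set.Ici s) s := by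
    intro s
    rw [← hasDerivWithinAt_Ioi_iff_Ici]
    refine ((v.d0 s).mul (ce_deriv (-γ) s).hasDerivWithinAt).congr_deriv ?_
    have := hz s
    linear_combination ce (-γ) s * this
  have hconst : ∀ a b, a ≤ b → v.f0 b * ce (-γ) b = v.f0 a * ce (-γ) a := fun a b hab =>
    constant_of_has_deriv_right_zero ((v.c0.mul (ce_cont (-γ))).continuousOn)
      (fun x _ => hder x) b ⟨hab, le_rfl⟩
  have hlim : Filter.Tendsto (fun s => v.f0 s * ce (-γ) s) Filter.atTop (nhds 0) := by
    have hG := (good_exp_schwartz (by linarith : 1 ≤ 2 * γ) f).tendsto_top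
    rw [tendsto_zero_iff_norm_tendsto_zero] at hG ⊢
    refine squeeze_zero' (Filter.Eventually.of_forall fun s => norm_nonneg _) ?_ hG
    filter_upwards [Filter.eventually_ge_atTop (0:ℝ)] with s hs
    have hce : ce (-γ) s ≤ Real.exp (γ * s) := by
      have : Real.cosh s ≤ Real.exp s := by
        rw [Real.cosh_eq]
        have : Real.exp (-s) ≤ Real.exp s := Real.exp_le_exp.2 (by linarith)
        linarith
      unfold ce
      rw [neg_neg, mul_comm, Real.exp_mul]
      exact Real.rpow_le_rpow (Real.cosh_pos s).le this (by linarith)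
    have e : Real.exp (2 * γ * s) = Real.exp (γ * s) * Real.exp (γ * s) := by
      rw [← Real.exp_add]; ring_nf
    rw [hv, prof_f0, norm_mul, norm_mul, norm_mul, e, norm_mul]
    have h5 : ‖ce (-γ) s‖ ≤ ‖Real.exp (γ * s)‖ := by
      rw [Real.norm_eq_abs, Real.norm_eq_abs, abs_of_pos (ce_pos _ _), abs_of_pos (Real.exp_pos _)]
      exact hce
    calc ‖Real.exp (γ * s)‖ * ‖f (Real.exp s)‖ * ‖ce (-γ) s‖
        ≤ ‖Real.exp (γ * s)‖ * ‖f (Real.exp s)‖ * ‖Real.exp (γ * s)‖ := by gcongr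
      _ = _ := by ring
  intro r hr
  have h6 : v.f0 (Real.log r) * ce (-γ) (Real.log r) = 0 := by
    have : Filter.Tendsto (fun s => v.f0 s * ce (-γ) s) Filter.atTop
        (nhds (v.f0 (Real.log r) * ce (-γ) (Real.log r))) := by
      refine tendsto_const_nhds.congr' ?_
      filter_upwards [Filter.eventually_ge_atTop (Real.log r)] with s hs
      exact (hconst _ _ hs).symm
    exact tendsto_nhds_unique this hlim
  rcases mul_eq_zero.1 h6 with h7 | h7
  · rw [hv, prof_f0, Real.exp_log hr] at h7
    exact (mul_eq_zero.1 h7).resolve_left (Real.exp_pos _).ne'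
  · exact absurd h7 (ce_pos _ _).ne'

/-! ### Integration of radial functions -/

def omN (N : ℕ) : ℝ := (N : ℝ) * volume.real (Metric.ball (0 : Rn N) 1)

lemma integral_exp_change (F : ℝ → ℝ) :
    ∫ r in Set.Ioi (0:ℝ), F r = ∫ s, Real.exp s * F (Real.exp s) := by
  have := integral_image_eq_integral_abs_deriv_smul (s := Set.univ) (f := Real.exp)
    (f' := Real.exp) MeasurableSet.univ
    (fun x _ => (Real.hasDerivAt_exp x).hasDerivWithinAt) Real.exp_injective.injOn F
  rw [Set.image_univ, Real.range_exp, Measure.restrict_univ] at this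
  rw [this]
  simp

lemma integral_radial {N : ℕ} (hN : 1 ≤ N) (F : ℝ → ℝ) :
    ∫ x : Rn N, F ‖x‖ = omN N * ∫ s, Real.exp (N * s) * F (Real.exp s) := by
  have : Nontrivial (Rn N) := by
    have : Nonempty (Fin N) := ⟨⟨0, hN⟩⟩
    infer_instance
  rw [integral_fun_norm_addHaar volume F, integral_exp_change]
  simp only [finrank_euclideanSpace, Fintype.card_fin, smul_eq_mul, nsmul_eq_mul, omN]
  rw [mul_assoc]
  congr 2
  apply integral_congr_ae
  refine Filter.Eventually.of_forall fun s => ?_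
  simp only
  rw [← mul_assoc, ← Real.exp_nat_mul, ← Real.exp_add]
  congr 2
  push_cast [Nat.cast_sub hN]
  ring

lemma omN_pos {N : ℕ} (hN : 1 ≤ N) : 0 < omN N := by
  unfold omN
  have h1 : 0 < volume.real (Metric.ball (0 : Rn N) 1) :=
    ENNReal.toReal_pos (Metric.measure_ball_pos _ _ one_pos).ne' measure_ball_lt_top.ne
  have : (0:ℝ) < N := by exact_mod_cast hN
  positivity

def unitv (N : ℕ) (hN : 1 ≤ N) : Rn N := EuclideanSpace.single ⟨0, hN⟩ 1

lemma norm_unitv (N : ℕ) (hN : 1 ≤ N) : ‖unitv N hN‖ = 1 := by simp [unitv]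

lemma ray_growth {N : ℕ} (hN : 1 ≤ N) :
    Function.HasTemperateGrowth (fun r : ℝ => r • unitv N hN) :=
  (ContinuousLinearMap.toSpanSingleton ℝ (unitv N hN)).hasTemperateGrowth

lemma ray_anti {N : ℕ} (hN : 1 ≤ N) :
    AntilipschitzWith 1 (fun r : ℝ => r • unitv N hN) :=
  AntilipschitzWith.of_le_mul_dist fun x y => by
    rw [dist_eq_norm, dist_eq_norm, ← sub_smul, norm_smul, norm_unitv]; simp

def ray {N : ℕ} (hN : 1 ≤ N) (g : SchwartzMap (Rn N) ℝ) : SchwartzMap ℝ ℝ :=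
  SchwartzMap.compCLMOfAntilipschitz ℝ (ray_growth hN) (ray_anti hN) g

lemma ray_apply {N : ℕ} (hN : 1 ≤ N) (g : SchwartzMap (Rn N) ℝ) (r : ℝ) :
    ray hN g r = g (r • unitv N hN) := rfl

lemma ray_norm {N : ℕ} (hN : 1 ≤ N) (g : SchwartzMap (Rn N) ℝ)
    (hg : ∀ x y : Rn N, ‖x‖ = ‖y‖ → g x = g y) (x : Rn N) : g x = ray hN g ‖x‖ := by
  rw [ray_apply]
  apply hg
  rw [norm_smul, norm_unitv]; simp

lemma hasFDerivAt_norm' {N : ℕ} {x : Rn N} (hx : x ≠ 0) :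
    HasFDerivAt (fun y : Rn N => ‖y‖) (‖x‖⁻¹ • innerSL ℝ x) x := by
  have h := (hasStrictFDerivAt_norm_sq x).hasFDerivAt
  have hx0 : ‖x‖ ≠ 0 := norm_ne_zero_iff.2 hx
  have h2 := h.sqrt (by positivity)
  have e : (fun y : Rn N => Real.sqrt (‖y‖ ^ 2)) = fun y => ‖y‖ := by
    ext y; exact Real.sqrt_sq (norm_nonneg _)
  rw [e, Real.sqrt_sq (norm_nonneg _)] at h2
  refine h2.congr_fderiv ?_
  ext z
  simp
  field_simp

lemma fderiv_radial {N : ℕ} (hN : 1 ≤ N) (g : SchwartzMap (Rn N) ℝ)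
    (hg : ∀ x y : Rn N, ‖x‖ = ‖y‖ → g x = g y) {x : Rn N} (hx : x ≠ 0) (z : Rn N) :
    fderiv ℝ g x z = SchwartzMap.derivCLM ℝ ℝ (ray hN g) ‖x‖ / ‖x‖ * inner ℝ x z := by
  have h1 := ((ray hN g).hasDerivAt ‖x‖).comp_hasFDerivAt x (hasFDerivAt_norm' hx)
  have e : (ray hN g) ∘ (fun y : Rn N => ‖y‖) = g := by
    ext y; exact (ray_norm hN g hg y).symm
  rw [e] at h1
  rw [h1.fderiv, SchwartzMap.derivCLM_apply]
  simp
  ring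

lemma lapR_radial {N : ℕ} (hN : 1 ≤ N) (g : SchwartzMap (Rn N) ℝ)
    (hg : ∀ x y : Rn N, ‖x‖ = ‖y‖ → g x = g y) {x : Rn N} (hx : x ≠ 0) :
    lapR g x = lapG N (ray hN g) ‖x‖ := by
  have hx0 : ‖x‖ ≠ 0 := norm_ne_zero_iff.2 hx
  set G1 := SchwartzMap.derivCLM ℝ ℝ (ray hN g) with hG1
  -- derivative of H
  have hHd : HasDerivAt (fun r => G1 r / r)
      ((deriv G1 ‖x‖ * ‖x‖ - G1 ‖x‖ * 1) / ‖x‖ ^ 2) ‖x‖ :=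
    (G1.hasDerivAt ‖x‖).div (hasDerivAt_id _) hx0
  have hH := hHd.comp_hasFDerivAt x (hasFDerivAt_norm' hx)
  set κ := (deriv G1 ‖x‖ * ‖x‖ - G1 ‖x‖ * 1) / ‖x‖ ^ 2 with hκ
  have hterm : ∀ i : Fin N, iteratedFDeriv ℝ 2 g x (fun _ => EuclideanSpace.single i 1)
      = κ * ‖x‖⁻¹ * (x i) ^ 2 + G1 ‖x‖ / ‖x‖ := by
    intro i
    rw [iteratedFDeriv_two_apply]
    have hdiff : DifferentiableAt ℝ (fderiv ℝ g) x :=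
      ((g.smooth 2).fderiv_right (m := 1) (by norm_num)).differentiable (by norm_num) x
    have e1 : fderiv ℝ (fun y => fderiv ℝ g y (EuclideanSpace.single i 1)) x
        (EuclideanSpace.single i 1)
        = fderiv ℝ (fderiv ℝ g) x (EuclideanSpace.single i 1) (EuclideanSpace.single i 1) := by
      have := (hdiff.hasFDerivAt.clm_apply
        (hasFDerivAt_const (EuclideanSpace.single i (1:ℝ)) x)).fderiv
      rw [this]; simp
    rw [← e1]
    have e2 : (fun y => fderiv ℝ g y (EuclideanSpace.single i 1)) =ᶠ[nhds x]
        fun y => ((fun r => G1 r / r) ∘ fun y : Rn N => ‖y‖) y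
          * (inner ℝ (EuclideanSpace.single i (1:ℝ)) y : ℝ) := by
      filter_upwards [isOpen_ne.mem_nhds hx] with y hy
      rw [fderiv_radial hN g hg hy, real_inner_comm]
      rfl
    rw [e2.fderiv_eq]
    have h3 := hH.mul ((innerSL ℝ (EuclideanSpace.single i (1:ℝ) : Rn N)).hasFDerivAt (x := x))
    have h4 := h3.fderiv
    have h5 : (fun y => ((fun r => G1 r / r) ∘ fun y : Rn N => ‖y‖) y
          * (inner ℝ (EuclideanSpace.single i (1:ℝ)) y : ℝ)) =
        ((fun r => G1 r / r) ∘ fun y : Rn N => ‖y‖) *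
          ⇑(innerSL ℝ (EuclideanSpace.single i (1:ℝ) : Rn N)) := by
      ext y; simp
    rw [h5, h4]
    simp [EuclideanSpace.inner_single_left, EuclideanSpace.inner_single_right]
    ring
  unfold lapR lapG
  rw [Finset.sum_congr rfl fun i _ => hterm i, Finset.sum_add_distrib, ← Finset.mul_sum,
    ← EuclideanSpace.real_norm_sq_eq]
  simp only [Finset.sum_const, Finset.card_univ, Fintype.card_fin, nsmul_eq_mul]
  rw [← hG1, show SchwartzMap.derivCLM ℝ ℝ G1 ‖x‖ = deriv G1 ‖x‖ from rfl, hκ]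
  field_simp
  ring

def lam0 (γ : ℝ) : ℝ := γ * (γ + 1) * (γ + 2) * (γ + 3)

def cW (γ : ℝ) : ℝ := (16 * lam0 γ) ^ (γ / 4)

lemma cW_pos {γ : ℝ} (hγ : 1 ≤ γ) : 0 < cW γ := by
  unfold cW lam0
  apply Real.rpow_pos_of_pos
  positivity

lemma W_eq {N : ℕ} {γ : ℝ} (hN : (N : ℝ) = 2 * γ + 4) (x : Rn N) :
    Wfun N x = cW γ * (1 + ‖x‖ ^ 2) ^ (-γ) := by
  unfold Wfun cW lam0
  rw [hN]
  congr 2 <;> ring_nf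

lemma V_eq {N : ℕ} {γ : ℝ} (hγ : 1 ≤ γ) (hN : (N : ℝ) = 2 * γ + 4) (x : Rn N) :
    Wfun N x ^ ((8 : ℝ) / ((N : ℝ) - 4)) = 16 * lam0 γ * ((1 + ‖x‖ ^ 2) ^ 4)⁻¹ := by
  have h0 : 0 < 16 * lam0 γ := by unfold lam0; positivity
  have h1 : 0 < 1 + ‖x‖ ^ 2 := by positivity
  have hγ0 : γ ≠ 0 := by linarith
  rw [W_eq hN, Real.mul_rpow (cW_pos hγ).le (Real.rpow_pos_of_pos h1 _).le, cW,
    ← Real.rpow_mul h0.le, ← Real.rpow_mul h1.le, hN]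
  have e1 : γ / 4 * (8 / (2 * γ + 4 - 4)) = 1 := by
    rw [add_sub_cancel_right]; field_simp; norm_num
  have e2 : -γ * (8 / (2 * γ + 4 - 4)) = -((4 : ℕ) : ℝ) := by
    rw [add_sub_cancel_right]; field_simp; norm_num
  rw [e1, e2, Real.rpow_one, Real.rpow_neg h1.le, Real.rpow_natCast]

lemma sg_exp (s : ℝ) : sg s = 4 * Real.exp s ^ 2 / (1 + Real.exp s ^ 2) ^ 2 := by
  rw [sg_eq, Real.cosh_eq, Real.exp_neg]
  have := Real.exp_pos s
  field_simp
  ring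

lemma ae_ne_zero {N : ℕ} (hN : 1 ≤ N) : ∀ᵐ x : Rn N, x ≠ 0 := by
  have : Nontrivial (Rn N) := by
    have : Nonempty (Fin N) := ⟨⟨0, hN⟩⟩
    infer_instance
  exact Measure.ae_ne volume (0 : Rn N)

lemma expN {N : ℕ} {γ : ℝ} (hN : (N : ℝ) = 2 * γ + 4) (s : ℝ) :
    Real.exp (N * s) = Real.exp (γ * s) * Real.exp (γ * s) * Real.exp s ^ 4 := by
  rw [← Real.exp_nat_mul, ← Real.exp_add, ← Real.exp_add, hN]; congr 1; push_cast; ring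

lemma exp2 (γ s : ℝ) : Real.exp ((γ + 2) * s) = Real.exp (γ * s) * Real.exp s ^ 2 := by
  rw [← Real.exp_nat_mul, ← Real.exp_add]; congr 1; push_cast; ring

lemma integral_radial_eq {N : ℕ} (hN1 : 1 ≤ N) {u : Rn N → ℝ} {k : ℝ → ℝ} (F : ℝ → ℝ)
    (hu : ∀ x, x ≠ 0 → u x = F ‖x‖) (hk : ∀ s, Real.exp (N * s) * F (Real.exp s) = k s) :
    ∫ x, u x = omN N * ∫ s, k s := by
  have h1 : ∫ x : Rn N, u x = ∫ x : Rn N, F ‖x‖ := by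
    apply integral_congr_ae
    filter_upwards [ae_ne_zero hN1] with x hx using hu x hx
  rw [h1, integral_radial hN1]
  simp only [hk]

lemma I_lap {N : ℕ} {γ : ℝ} (hN1 : 1 ≤ N) (hγ : 1 ≤ γ) (hN : (N : ℝ) = 2 * γ + 4)
    (f g : SchwartzMap (Rn N) ℝ)
    (hf : ∀ x y : Rn N, ‖x‖ = ‖y‖ → f x = f y)
    (hg : ∀ x y : Rn N, ‖x‖ = ‖y‖ → g x = g y) : ∫ x : Rn N, lapR f x * lapR g x
    = omN N * Efm γ (prof hγ (ray hN1 f)) (prof hγ (ray hN1 g)) := by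
  rw [Efm_apply]
  refine integral_radial_eq hN1 (fun r => lapG N (ray hN1 f) r * lapG N (ray hN1 g) r)
    (fun x hx => by rw [lapR_radial hN1 f hf hx, lapR_radial hN1 g hg hx]) fun s => ?_
  rw [prof_D hγ hN, prof_D hγ hN, expN hN, exp2]
  ring

lemma I_in {N : ℕ} {γ : ℝ} (hN1 : 1 ≤ N) (hγ : 1 ≤ γ) (hN : (N : ℝ) = 2 * γ + 4)
    (g : SchwartzMap (Rn N) ℝ)
    (hg : ∀ x y : Rn N, ‖x‖ = ‖y‖ → g x = g y) (s1 : ℝ) :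
    ∫ x in {y : Rn N | ‖y‖ ≤ Real.exp s1}, (lapR g x) ^ 2
    = omN N * ∫ s in Set.Iio s1, ((prof hγ (ray hN1 g)).D γ s) ^ 2 := by
  rw [← integral_Iic_eq_integral_Iio, ← integral_indicator measurableSet_Iic,
    ← integral_indicator (measurableSet_le (by fun_prop) (by fun_prop))]
  refine integral_radial_eq hN1
    (fun r => if r ≤ Real.exp s1 then (lapG N (ray hN1 g) r) ^ 2 else 0)
    (fun x hx => by
      simp only [Set.indicator, Set.mem_ofPred_eq, lapR_radial hN1 g hg hx]) fun s => ?_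
  simp only [Set.indicator, Set.mem_Iic, Real.exp_le_exp]
  split_ifs
  · rw [prof_D hγ hN, expN hN, exp2]
    ring
  · simp

lemma I_out {N : ℕ} {γ : ℝ} (hN1 : 1 ≤ N) (hγ : 1 ≤ γ) (hN : (N : ℝ) = 2 * γ + 4)
    (g : SchwartzMap (Rn N) ℝ)
    (hg : ∀ x y : Rn N, ‖x‖ = ‖y‖ → g x = g y) (s1 : ℝ) :
    ∫ x in {y : Rn N | Real.exp s1 ≤ ‖y‖}, (lapR g x) ^ 2
    = omN N * ∫ s in Set.Ici s1, ((prof hγ (ray hN1 g)).D γ s) ^ 2 := by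
  rw [← integral_indicator measurableSet_Ici,
    ← integral_indicator (measurableSet_le (by fun_prop) (by fun_prop))]
  refine integral_radial_eq hN1
    (fun r => if Real.exp s1 ≤ r then (lapG N (ray hN1 g) r) ^ 2 else 0)
    (fun x hx => by
      simp only [Set.indicator, Set.mem_ofPred_eq, lapR_radial hN1 g hg hx]) fun s => ?_
  simp only [Set.indicator, Set.mem_Ici, Real.exp_le_exp]
  split_ifs
  · rw [prof_D hγ hN, expN hN, exp2]
    ring
  · simp

lemma I_V {N : ℕ} {γ : ℝ} (hN1 : 1 ≤ N) (hγ : 1 ≤ γ) (hN : (N : ℝ) = 2 * γ + 4)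
    (f g : SchwartzMap (Rn N) ℝ)
    (hf : ∀ x y : Rn N, ‖x‖ = ‖y‖ → f x = f y)
    (hg : ∀ x y : Rn N, ‖x‖ = ‖y‖ → g x = g y) :
    ∫ x : Rn N, Wfun N x ^ ((8 : ℝ) / ((N : ℝ) - 4)) * (f x * g x)
    = omN N * (lam0 γ * Pfm (prof hγ (ray hN1 f)) (prof hγ (ray hN1 g))) := by
  rw [Pfm_apply, ← integral_const_mul]
  refine integral_radial_eq hN1
    (fun r => 16 * lam0 γ * ((1 + r ^ 2) ^ 4)⁻¹ * (ray hN1 f r * ray hN1 g r))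
    (fun x hx => by rw [V_eq hγ hN, ray_norm hN1 f hf, ray_norm hN1 g hg]) fun s => ?_
  rw [prof_f0, prof_f0, expN hN, sg_exp]
  have := Real.exp_pos s
  field_simp
  ring

lemma I_W {N : ℕ} {γ : ℝ} (hN1 : 1 ≤ N) (hγ : 1 ≤ γ) (hγ9 : 9 / 2 ≤ γ) (hN : (N : ℝ) = 2 * γ + 4)
    (g : SchwartzMap (Rn N) ℝ)
    (hg : ∀ x y : Rn N, ‖x‖ = ‖y‖ → g x = g y) :
    ∫ x : Rn N, Wfun N x * g x
    = omN N * (cW γ * 2 ^ (-γ) * Mfm hγ9 (prof hγ (ray hN1 g))) := by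
  rw [Mfm_apply, ← integral_const_mul]
  refine integral_radial_eq hN1
    (fun r => cW γ * (1 + r ^ 2) ^ (-γ) * ray hN1 g r)
    (fun x hx => by rw [W_eq hN, ray_norm hN1 g hg]) fun s => ?_
  have he := Real.exp_pos s
  have e1 : (1 + Real.exp s ^ 2) ^ (-γ) = 2 ^ (-γ) * (Real.exp (-(γ * s)) * ce γ s) := by
    have : 1 + Real.exp s ^ 2 = 2 * (Real.exp s * Real.cosh s) := by
      rw [Real.cosh_eq, Real.exp_neg]; field_simp; ring
    rw [this, Real.mul_rpow (by norm_num) (mul_pos he (Real.cosh_pos s)).le,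
      Real.mul_rpow he.le (Real.cosh_pos s).le, ← Real.exp_mul, ce]
    congr 3; ring
  have e2 : Real.exp (4 * s) = Real.exp s ^ 4 := by
    rw [← Real.exp_nat_mul]; norm_num
  rw [prof_f0, expN hN, e1, mw, e2, Real.exp_neg]
  have := Real.exp_pos (γ * s)
  field_simp

/-! ### Schwartz integration by parts -/

open scoped Laplacian in
lemma lapR_eq {N : ℕ} (f : SchwartzMap (Rn N) ℝ) : lapR f = ⇑(Δ f : SchwartzMap (Rn N) ℝ) := by
  ext x
  rw [SchwartzMap.laplacian_apply,
    InnerProductSpace.laplacian_eq_iteratedFDeriv_orthonormalBasis f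
      (EuclideanSpace.basisFun (Fin N) ℝ), lapR]
  refine Finset.sum_congr rfl fun i _ => ?_
  congr 1
  ext j
  fin_cases j <;> simp

lemma ibp {N : ℕ} (f g : SchwartzMap (Rn N) ℝ) :
    ∫ x, lapR (lapR f) x * g x = ∫ x, lapR f x * lapR g x := by
  rw [lapR_eq f, lapR_eq g, lapR_eq]
  exact (SchwartzMap.integral_mul_laplacian_right_eq_left _ _).symm

lemma schwartz_mul_int {N : ℕ} (f g : SchwartzMap (Rn N) ℝ) :
    Integrable (fun x => f x * g x) := by
  obtain ⟨C, hC, h⟩ := g.decay 0 0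
  refine (f.integrable (μ := volume)).mul_bdd (c := C) g.continuous.aestronglyMeasurable
    (Filter.Eventually.of_forall fun x => ?_)
  simpa using h x

lemma V_mul_int {N : ℕ} {γ : ℝ} (hγ : 1 ≤ γ) (hN : (N : ℝ) = 2 * γ + 4)
    (f g : SchwartzMap (Rn N) ℝ) :
    Integrable (fun x => Wfun N x ^ ((8 : ℝ) / ((N : ℝ) - 4)) * (f x * g x)) := by
  simp only [V_eq hγ hN]
  have h0 : 0 < 16 * lam0 γ := by unfold lam0; positivity
  refine (schwartz_mul_int f g).bdd_mul (c := 16 * lam0 γ) ?_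
    (Filter.Eventually.of_forall fun x => ?_)
  · refine Continuous.aestronglyMeasurable ?_
    refine continuous_const.mul (Continuous.inv₀ (by fun_prop) fun x => ?_)
    positivity
  · rw [Real.norm_eq_abs, abs_of_nonneg (by positivity)]
    refine mul_le_of_le_one_right h0.le (inv_le_one_of_one_le₀ ?_)
    apply one_le_pow₀
    linarith [sq_nonneg ‖x‖]

/-- weak form of an eigenvalue-type equation -/
lemma weak {N : ℕ} {γ : ℝ} (hN1 : 1 ≤ N) (hγ : 1 ≤ γ) (hN : (N : ℝ) = 2 * γ + 4)
    (f h g : SchwartzMap (Rn N) ℝ)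
    (hf : ∀ x y : Rn N, ‖x‖ = ‖y‖ → f x = f y)
    (hg : ∀ x y : Rn N, ‖x‖ = ‖y‖ → g x = g y) (a b : ℝ)
    (heq : ∀ x : Rn N, lapR (lapR f) x
      - a * Wfun N x ^ ((8 : ℝ) / ((N : ℝ) - 4)) * f x = b * h x) :
    omN N * (Efm γ (prof hγ (ray hN1 f)) (prof hγ (ray hN1 g))
      - a * lam0 γ * Pfm (prof hγ (ray hN1 f)) (prof hγ (ray hN1 g))) = b * ∫ x, h x * g x := by
  have h1 : ∫ x, lapR (lapR f) x * g x
      = ∫ x, (a * (Wfun N x ^ ((8 : ℝ) / ((N : ℝ) - 4)) * (f x * g x)) + b * (h x * g x)) := by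
    congr 1; ext x
    linear_combination g x * heq x
  rw [integral_add ((V_mul_int hγ hN f g).const_mul a) ((schwartz_mul_int h g).const_mul b),
    integral_const_mul, integral_const_mul, ibp, I_lap hN1 hγ hN f g hf hg,
    I_V hN1 hγ hN f g hf hg] at h1
  linarith

theorem stmt_14 (N : ℕ) (hN : 13 ≤ N) (ν : ℝ) (hν : 0 < ν)
    (Y1 Y2 : SchwartzMap (Rn N) ℝ)
    (hY1rad : ∀ x y : Rn N, ‖x‖ = ‖y‖ → Y1 x = Y1 y)
    (hY2rad : ∀ x y : Rn N, ‖x‖ = ‖y‖ → Y2 x = Y2 y)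
    (hY1norm : (∫ x : Rn N, (Y1 x) ^ 2) = 1)
    (hY2norm : (∫ x : Rn N, (Y2 x) ^ 2) = 1)
    (hY1eq : ∀ x : Rn N,
      lapR (lapR (⇑Y1)) x
          - (((N : ℝ) + 4) / ((N : ℝ) - 4)) * Wfun N x ^ ((8 : ℝ) / ((N : ℝ) - 4)) * Y1 x
        = -ν * Y2 x)
    (hY2eq : ∀ x : Rn N,
      lapR (lapR (⇑Y2)) x - Wfun N x ^ ((8 : ℝ) / ((N : ℝ) - 4)) * Y2 x = ν * Y1 x) :
    ∃ c C r1 : ℝ, 0 < c ∧ c < 1 / 2 ∧ 0 < C ∧ 0 < r1 ∧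
      ∀ g : SchwartzMap (Rn N) ℝ,
        (∀ x y : Rn N, ‖x‖ = ‖y‖ → g x = g y) →
        (1 - 2 * c) * (∫ x in {y : Rn N | ‖y‖ ≤ r1}, (lapR (⇑g) x) ^ 2)
            + c * (∫ x in {y : Rn N | r1 ≤ ‖y‖}, (lapR (⇑g) x) ^ 2)
            - (((N : ℝ) + 4) / ((N : ℝ) - 4))
              * (∫ x : Rn N, Wfun N x ^ ((8 : ℝ) / ((N : ℝ) - 4)) * (g x) ^ 2)
          ≥ -C * ((∫ x : Rn N, Wfun N x * g x) ^ 2 + (∫ x : Rn N, Y2 x * g x) ^ 2) := by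
  obtain ⟨γ, hNγ⟩ : ∃ γ : ℝ, (N : ℝ) = 2 * γ + 4 := ⟨((N : ℝ) - 4) / 2, by ring⟩
  have hNr : (13 : ℝ) ≤ N := by exact_mod_cast hN
  have hγ9 : 9 / 2 ≤ γ := by linarith
  have hγ : 1 ≤ γ := by linarith
  have hγ0 : γ ≠ 0 := by linarith
  have hN1 : 1 ≤ N := by omega
  have hω := omN_pos hN1
  have hlam : ((N : ℝ) + 4) / ((N : ℝ) - 4) * lam0 γ = lam1 γ := by
    rw [hNγ, add_sub_cancel_right, lam0, lam1]
    field_simp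
    ring
  set y1 := prof hγ (ray hN1 Y1) with hy1
  set y2 := prof hγ (ray hN1 Y2) with hy2
  -- weak form of the first equation
  have hQ : ∀ g : SchwartzMap (Rn N) ℝ, (∀ x y : Rn N, ‖x‖ = ‖y‖ → g x = g y) →
      omN N * Qfm γ y1 (prof hγ (ray hN1 g)) = -ν * ∫ x, Y2 x * g x := by
    intro g hg
    have := weak hN1 hγ hNγ Y1 Y2 g hY1rad hg (((N : ℝ) + 4) / ((N : ℝ) - 4)) (-ν) hY1eq
    rw [hlam] at this
    exact this
  -- the form of the second equation
  have hL : omN N * (Efm γ y2 y2 - lam0 γ * Pfm y2 y2) = ν * ∫ x, Y1 x * Y2 x := by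
    have := weak hN1 hγ hNγ Y2 Y1 Y2 hY2rad hY2rad 1 ν (fun x => by rw [one_mul]; exact hY2eq x)
    rw [one_mul] at this
    exact this
  have hpos : 0 < Efm γ y2 y2 - lam0 γ * Pfm y2 y2 := by
    by_contra hneg
    push Not at hneg
    have hzero := Lminus_strict hγ (ray hN1 Y2) hneg
    have : ∫ x : Rn N, (Y2 x) ^ 2 = 0 := by
      rw [← integral_zero (Rn N) ℝ]
      apply integral_congr_ae
      filter_upwards [ae_ne_zero hN1] with x hx
      rw [ray_norm hN1 Y2 hY2rad, hzero _ (norm_pos_iff.2 hx)]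
      simp
    rw [hY2norm] at this
    exact one_ne_zero this
  have hy : Qfm γ y1 y1 < 0 := by
    have h1 := hQ Y1 hY1rad
    have h2 : ∫ x, Y2 x * Y1 x = ∫ x, Y1 x * Y2 x := by simp only [mul_comm]
    rw [h2, neg_mul, ← hL, ← hy1] at h1
    nlinarith [mul_pos hω hpos]
  obtain ⟨c, C, s1, hc0, hc1, hC, hmain⟩ := oneD hγ9 y1 hy
  set κ : ℝ := cW γ * 2 ^ (-γ) with hκ
  have hκ0 : 0 < κ := mul_pos (cW_pos hγ) (Real.rpow_pos_of_pos (by norm_num) _)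
  refine ⟨c, omN N * C * (1 / (omN N * κ) ^ 2 + (ν / omN N) ^ 2), Real.exp s1, hc0, hc1,
    by positivity, Real.exp_pos _, fun g hg => ?_⟩
  rw [I_in hN1 hγ hNγ g hg, I_out hN1 hγ hNγ g hg, I_W hN1 hγ hγ9 hNγ g hg]
  have hV : ∫ x : Rn N, Wfun N x ^ ((8 : ℝ) / ((N : ℝ) - 4)) * (g x) ^ 2
      = omN N * (lam0 γ * Pfm (prof hγ (ray hN1 g)) (prof hγ (ray hN1 g))) := by
    rw [← I_V hN1 hγ hNγ g g hg hg]
    simp only [sq]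
  have hg2 := hQ g hg
  have hm := hmain (prof hγ (ray hN1 g))
  rw [hV]
  set v := prof hγ (ray hN1 g)
  set I := ∫ x, Y2 x * g x
  set M := Mfm hγ9 v
  have hq : Qfm γ y1 v ^ 2 = (ν / omN N) ^ 2 * I ^ 2 := by
    have : Qfm γ y1 v = -(ν / omN N * I) := by
      field_simp
      linarith
    rw [this]; ring
  have hmm : M ^ 2 = 1 / (omN N * κ) ^ 2 * (omN N * (κ * M)) ^ 2 := by
    field_simp
  rw [hq, hmm] at hm
  have hm2 := mul_le_mul_of_nonneg_left hm hω.le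
  set T := (omN N * (κ * M)) ^ 2
  have hT : 0 ≤ T := sq_nonneg _
  set a := 1 / (omN N * κ) ^ 2
  set b := (ν / omN N) ^ 2
  have ha : 0 ≤ a := by positivity
  have hb : 0 ≤ b := by positivity
  have hI2 : 0 ≤ I ^ 2 := sq_nonneg _
  have k1 : 0 ≤ omN N * C * (a * I ^ 2 + b * T) := by positivity
  have k2 : ((N : ℝ) + 4) / ((N : ℝ) - 4) * (omN N * (lam0 γ * Pfm v v))
      = omN N * (lam1 γ * Pfm v v) := by rw [← hlam]; ring
  rw [k2, ge_iff_le]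
  refine le_trans ?_ (hm2.trans_eq ?_)
  · linarith
  · ring
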